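/- arXiv:2111.06880 — 13 statements merged into one kernel-verified Lean document; each statement's English description precedes it below -/
import Mathlib

section
/- Let v_1, …, v_r be unit vectors in ℝ^n with |⟨v_i, v_k⟩| < 1 for all i ≠ k, and let λ_1, …, λ_r be nonzero real numbers. Fix j ∈ {1,…,r}. Then there exists D ∈ ℕ such that for every d ≥ D and every μ ≠ 0, if F_d(v_j) = μ·v_j (i.e. v_j is an eigenvector of the tensor T_d = Σ_i λ_i v_i^{⊗d} with nonzero eigenvalue μ), then v_j is a robust (up to sign) eigenvector of F_d. -/
open Filter
open scoped RealInnerProductSpace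

section SymmetricPowerMap

variable {E ι : Type*} [NormedAddCommGroup E]

/-- The distance from `x` to the pair `{v, -v}`. -/
noncomputable def distUpToSign (v x : E) : ℝ := min ‖x - v‖ ‖x + v‖

lemma distUpToSign_neg (v x : E) : distUpToSign v (-x) = distUpToSign v x := by
  rw [distUpToSign, distUpToSign, min_comm, ← norm_neg (-x + v), ← norm_neg (-x - v)]
  congr 2 <;> abel_nf

lemma distUpToSign_nonneg (v x : E) : 0 ≤ distUpToSign v x :=
  le_min (norm_nonneg _) (norm_nonneg _)

variable [InnerProductSpace ℝ E] [Fintype ι]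

/-- The map `x ↦ ∑ i, c i ⟪v i, x⟫ ^ p v i`, i.e. the contraction of the symmetric tensor
`∑ i, c i • (v i)^{⊗ (p + 1)}` with `x^{⊗ p}`. -/
noncomputable def symmetricPowerMap (v : ι → E) (c : ι → ℝ) (p : ℕ) (x : E) : E :=
  ∑ i, (c i * ⟪v i, x⟫ ^ p) • v i

lemma symmetricPowerMap_neg (v : ι → E) (c : ι → ℝ) (p : ℕ) (x : E) :
    symmetricPowerMap v c p (-x) = (-1 : ℝ) ^ p • symmetricPowerMap v c p x := by
  simp only [symmetricPowerMap, Finset.smul_sum, smul_smul, inner_neg_right]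
  refine Finset.sum_congr rfl fun i _ => ?_
  rw [neg_pow]
  ring_nf

lemma distUpToSign_neg_one_pow_smul (v x : E) (p : ℕ) :
    distUpToSign v ((-1 : ℝ) ^ p • x) = distUpToSign v x := by
  rcases neg_one_pow_eq_or ℝ p with h | h <;> simp [h, distUpToSign_neg]

lemma mul_norm_normalize_sub_le {v : E} (hv : ‖v‖ = 1) (y : E) {b : ℝ} (hb : 0 ≤ b) :
    b * ‖‖y‖⁻¹ • y - v‖ ≤ 2 * ‖y - b • v‖ := by
  have hy : ‖y‖ • ‖y‖⁻¹ • y = y := by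
    rcases eq_or_ne y 0 with rfl | h
    · simp
    · rw [smul_smul, mul_inv_cancel₀ (norm_ne_zero_iff.2 h), one_smul]
  have hle : ‖‖y‖⁻¹ • y‖ ≤ 1 := by
    rw [norm_smul, norm_inv, norm_norm]
    exact inv_mul_le_one
  have hdist : |b - ‖y‖| ≤ ‖y - b • v‖ := by
    have h := abs_norm_sub_norm_le (b • v) y
    rwa [norm_smul, hv, mul_one, Real.norm_of_nonneg hb, norm_sub_rev] at h
  calc b * ‖‖y‖⁻¹ • y - v‖ = ‖(b - ‖y‖) • ‖y‖⁻¹ • y + (y - b • v)‖ := by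
        rw [← Real.norm_of_nonneg hb, ← norm_smul, Real.norm_of_nonneg hb, sub_smul, hy, smul_sub]
        congr 1
        abel
    _ ≤ |b - ‖y‖| * ‖‖y‖⁻¹ • y‖ + ‖y - b • v‖ := by
        rw [← Real.norm_eq_abs, ← norm_smul]
        exact norm_add_le _ _
    _ ≤ 2 * ‖y - b • v‖ := by nlinarith [abs_nonneg (b - ‖y‖)]

lemma abs_mul_distUpToSign_normalize_le {v : E} (hv : ‖v‖ = 1) (y : E) (b : ℝ) :
    |b| * distUpToSign v (‖y‖⁻¹ • y) ≤ 2 * ‖y - b • v‖ := by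
  rcases le_total 0 b with hb | hb
  · rw [abs_of_nonneg hb]
    exact (mul_le_mul_of_nonneg_left (min_le_left _ _) hb).trans
      (mul_norm_normalize_sub_le hv y hb)
  · rw [abs_of_nonpos hb]
    have h := mul_norm_normalize_sub_le (v := -v) (by rwa [norm_neg]) y (neg_nonneg.2 hb)
    rw [sub_neg_eq_add, smul_neg, neg_smul, neg_neg] at h
    exact (mul_le_mul_of_nonneg_left (min_le_right _ _) (neg_nonneg.2 hb)).trans h

/-- Orthogonally to the eigenvector `v j`, the power map contracts with rate `p * q ^ (p - 1)`. -/
lemma norm_symmetricPowerMap_sub_le {v : ι → E} (hv : ∀ i, ‖v i‖ = 1) (c : ι → ℝ) (p : ℕ)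
    {j : ι} {μ q : ℝ} (hq₀ : 0 ≤ q) (hμ : symmetricPowerMap v c p (v j) = μ • v j) {x : E}
    (h₁ : ∀ i, i ≠ j → |⟪v i, x⟫| ≤ q) (h₂ : ∀ i, i ≠ j → |⟪v j, x⟫ * ⟪v i, v j⟫| ≤ q) :
    ‖symmetricPowerMap v c p x - (⟪v j, x⟫ ^ p * μ) • v j‖ ≤
      (∑ i, |c i|) * (p * q ^ (p - 1)) * ‖x - v j‖ := by
  have hj : ⟪v j, v j⟫ = (1 : ℝ) := by rw [real_inner_self_eq_norm_sq, hv, one_pow]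
  have hproj : ‖x - ⟪v j, x⟫ • v j‖ ≤ ‖x - v j‖ := by
    have hx : ⟪v j, x - ⟪v j, x⟫ • v j⟫ = (0 : ℝ) := by
      rw [inner_sub_right, real_inner_smul_right, hj, mul_one, sub_self]
    have h : ‖x - v j‖ ^ 2 = ‖x - ⟪v j, x⟫ • v j‖ ^ 2 + ‖(⟪v j, x⟫ - 1) • v j‖ ^ 2 := by
      rw [show x - v j = (x - ⟪v j, x⟫ • v j) + (⟪v j, x⟫ - 1) • v j by
        rw [sub_smul, one_smul]; abel, norm_add_sq_real, real_inner_smul_right,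
        real_inner_comm (v j), hx]
      ring
    exact le_of_sq_le_sq (by nlinarith [sq_nonneg ‖(⟪v j, x⟫ - 1) • v j‖]) (norm_nonneg _)
  rw [mul_smul, ← hμ, symmetricPowerMap, symmetricPowerMap, Finset.smul_sum,
    ← Finset.sum_sub_distrib, mul_assoc, Finset.sum_mul]
  refine norm_sum_le_of_le _ fun i _ => ?_
  rw [smul_smul, ← sub_smul, norm_smul, hv, mul_one, Real.norm_eq_abs]
  rw [show c i * ⟪v i, x⟫ ^ p - ⟪v j, x⟫ ^ p * (c i * ⟪v i, v j⟫ ^ p) =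
    c i * (⟪v i, x⟫ ^ p - (⟪v j, x⟫ * ⟪v i, v j⟫) ^ p) by rw [mul_pow]; ring, abs_mul]
  refine mul_le_mul_of_nonneg_left ?_ (abs_nonneg _)
  by_cases hij : i = j
  · subst hij
    rw [hj, mul_one, sub_self, abs_zero]
    positivity
  · have hdiff : |⟪v i, x⟫ - ⟪v j, x⟫ * ⟪v i, v j⟫| ≤ ‖x - v j‖ := by
      rw [← real_inner_smul_right, ← inner_sub_right]
      refine (abs_real_inner_le_norm _ _).trans ?_
      rwa [hv, one_mul]
    calc |⟪v i, x⟫ ^ p - (⟪v j, x⟫ * ⟪v i, v j⟫) ^ p|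
        ≤ |⟪v i, x⟫ - ⟪v j, x⟫ * ⟪v i, v j⟫| * p *
            max |⟪v i, x⟫| |⟪v j, x⟫ * ⟪v i, v j⟫| ^ (p - 1) := abs_pow_sub_pow_le _ _ _
      _ ≤ ‖x - v j‖ * p * q ^ (p - 1) := by
          gcongr
          exact max_le (h₁ i hij) (h₂ i hij)
      _ = p * q ^ (p - 1) * ‖x - v j‖ := by ring

/-- The eigenvalue of the generator `v j` is close to `c j`. -/
lemma abs_eigenvalue_sub_le {v : ι → E} (hv : ∀ i, ‖v i‖ = 1) (c : ι → ℝ) (p : ℕ)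
    {j : ι} {μ q : ℝ} (hq₀ : 0 ≤ q) (hq₁ : q ≤ 1)
    (hμ : symmetricPowerMap v c p (v j) = μ • v j)
    (hq : ∀ i, i ≠ j → |⟪v i, v j⟫| ≤ q) :
    |μ - c j| ≤ (∑ i, |c i|) * q ^ p := by
  classical
  have hj : ⟪v j, v j⟫ = (1 : ℝ) := by rw [real_inner_self_eq_norm_sq, hv, one_pow]
  have h : μ = ∑ i, c i * ⟪v i, v j⟫ ^ (p + 1) := by
    have := congrArg (fun y => (⟪y, v j⟫ : ℝ)) hμ
    simp only [symmetricPowerMap, sum_inner, real_inner_smul_left, hj, mul_one] at this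
    rw [← this]
    exact Finset.sum_congr rfl fun i _ => by ring
  rw [h, ← Finset.add_sum_erase _ _ (Finset.mem_univ j), hj, one_pow, mul_one,
    add_sub_cancel_left, Finset.sum_mul]
  refine (Finset.abs_sum_le_sum_abs _ _).trans ?_
  refine (Finset.sum_le_sum fun i hi => ?_).trans (Finset.sum_le_sum_of_subset_of_nonneg
    (Finset.erase_subset j _) fun i _ _ => by positivity)
  rw [abs_mul, abs_pow]
  refine mul_le_mul_of_nonneg_left ?_ (abs_nonneg _)
  calc |⟪v i, v j⟫| ^ (p + 1) ≤ q ^ (p + 1) := by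
        gcongr
        exact hq i (Finset.ne_of_mem_erase hi)
    _ ≤ q ^ p := pow_le_pow_of_le_one hq₀ hq₁ p.le_succ

/-- If the order is large enough, the normalized power map halves the distance to `±v j` near
`v j`. -/
lemma exists_distUpToSign_symmetricPowerMap_le {v : ι → E} (hv : ∀ i, ‖v i‖ = 1) (c : ι → ℝ)
    (p : ℕ) {j : ι} {μ q : ℝ} (hμ₀ : μ ≠ 0) (hq₀ : 0 ≤ q)
    (hμ : symmetricPowerMap v c p (v j) = μ • v j)
    (hq : ∀ i, i ≠ j → |⟪v i, v j⟫| < q)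
    (hsmall : (∑ i, |c i|) * (p * q ^ (p - 1)) ≤ |μ| / 8) :
    ∃ ε > (0 : ℝ), ∀ x, distUpToSign (v j) x < ε →
      distUpToSign (v j) (‖symmetricPowerMap v c p x‖⁻¹ • symmetricPowerMap v c p x) ≤
        1 / 2 * distUpToSign (v j) x := by
  have hj : ⟪v j, v j⟫ = (1 : ℝ) := by rw [real_inner_self_eq_norm_sq, hv, one_pow]
  have hev : ∀ᶠ x in nhds (v j), 1 / 2 < |⟪v j, x⟫ ^ p| ∧
      (∀ i, i ≠ j → |⟪v i, x⟫| < q) ∧ ∀ i, i ≠ j → |⟪v j, x⟫ * ⟪v i, v j⟫| < q := by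
    refine Eventually.and ?_ (Eventually.and ?_ ?_)
    · refine ContinuousAt.eventually_lt (by fun_prop) (by fun_prop) ?_
      rw [hj, one_pow, abs_one]
      norm_num
    · refine eventually_all.2 fun i => ?_
      by_cases hij : i = j
      · simp [hij]
      filter_upwards [ContinuousAt.eventually_lt (f := fun x => |⟪v i, x⟫|) (by fun_prop)
        (continuousAt_const (y := q)) (hq i hij)] with x hx _ using hx
    · refine eventually_all.2 fun i => ?_
      by_cases hij : i = j
      · simp [hij]
      filter_upwards [ContinuousAt.eventually_lt (x₀ := v j)
        (f := fun x => |⟪v j, x⟫ * ⟪v i, v j⟫|) (by fun_prop)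
        (continuousAt_const (y := q)) (by rw [hj, one_mul]; exact hq i hij)] with x hx _ using hx
  obtain ⟨ε, hε, hball⟩ := Metric.eventually_nhds_iff.1 hev
  have hnear : ∀ x, ‖x - v j‖ < ε →
      distUpToSign (v j) (‖symmetricPowerMap v c p x‖⁻¹ • symmetricPowerMap v c p x) ≤
        1 / 2 * ‖x - v j‖ := by
    intro x hx
    obtain ⟨ha, h₁, h₂⟩ := hball (by rwa [dist_eq_norm])
    have hb := norm_symmetricPowerMap_sub_le hv c p hq₀ hμ (fun i hi => (h₁ i hi).le)
      (fun i hi => (h₂ i hi).le)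
    have hn := abs_mul_distUpToSign_normalize_le (hv j) (symmetricPowerMap v c p x)
      (⟪v j, x⟫ ^ p * μ)
    have hd := distUpToSign_nonneg (v j)
      (‖symmetricPowerMap v c p x‖⁻¹ • symmetricPowerMap v c p x)
    have hμ' := abs_pos.2 hμ₀
    have hs := mul_le_mul_of_nonneg_right hsmall (norm_nonneg (x - v j))
    rw [abs_mul] at hn
    have hl := mul_le_mul_of_nonneg_right (mul_le_mul_of_nonneg_right ha.le hμ'.le) hd
    refine le_of_mul_le_mul_left ?_ hμ'
    linarith
  refine ⟨ε, hε, fun x hx => ?_⟩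
  rcases le_total ‖x - v j‖ ‖x + v j‖ with h | h
  · rw [distUpToSign, min_eq_left h] at hx
    rw [distUpToSign.eq_def (v j) x, min_eq_left h]
    exact hnear x hx
  · rw [distUpToSign, min_eq_right h] at hx
    have hneg : ‖-x - v j‖ = ‖x + v j‖ := by rw [← norm_neg, neg_sub, sub_neg_eq_add, add_comm]
    have := hnear (-x) (by rwa [hneg])
    rw [symmetricPowerMap_neg, norm_smul, norm_pow, norm_neg, norm_one, one_pow, one_mul,
      smul_comm, distUpToSign_neg_one_pow_smul, hneg] at this
    rwa [distUpToSign.eq_def (v j) x, min_eq_right h]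

end SymmetricPowerMap

/-- If `v j` is a generator of the symmetric decomposition
`T_d = ∑ i, λ i • (v i)^{⊗ d}` and is an eigenvector of `T_d` with nonzero eigenvalue,
then for all sufficiently large orders `d` it is a robust (up to sign) eigenvector of
the tensor power method. -/
theorem robust_eigenvector_of_generator {n r : ℕ}
    (v : Fin r → EuclideanSpace ℝ (Fin n)) (lam : Fin r → ℝ)
    (hunit : ∀ i, ‖v i‖ = 1)
    (hangle : ∀ i k : Fin r, i ≠ k → |(⟪v i, v k⟫)| < 1)
    (hlam : ∀ i, lam i ≠ 0) (j : Fin r) :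
    ∃ D : ℕ, ∀ d : ℕ, D ≤ d → ∀ μ : ℝ, μ ≠ 0 →
      (∑ i, (lam i * ⟪v i, v j⟫ ^ (d - 1)) • v i) = μ • v j →
      ∃ ε > (0 : ℝ), ∀ x : ℕ → EuclideanSpace ℝ (Fin n),
        ‖x 0 - v j‖ < ε →
        (∀ k : ℕ, x (k + 1) =
          ‖∑ i, (lam i * ⟪v i, x k⟫ ^ (d - 1)) • v i‖⁻¹ •
            (∑ i, (lam i * ⟪v i, x k⟫ ^ (d - 1)) • v i)) →
        Tendsto (fun k => min ‖x k - v j‖ ‖x k + v j‖) atTop (nhds 0) := by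
  have hq : ∃ q : ℝ, 0 < q ∧ q < 1 ∧ ∀ i, i ≠ j → |⟪v i, v j⟫| < q := by
    have hev : ∀ᶠ q in nhdsWithin (1 : ℝ) (Set.Iio 1), ∀ i, i ≠ j → |⟪v i, v j⟫| < q := by
      refine eventually_all.2 fun i => ?_
      by_cases hij : i = j
      · simp [hij]
      filter_upwards [nhdsWithin_le_nhds (lt_mem_nhds (hangle i j hij))] with q hq _ using hq
    obtain ⟨q, hq, hq₀, hq₁⟩ := (hev.and ((eventually_nhdsWithin_of_eventually_nhds
      (lt_mem_nhds one_pos)).and self_mem_nhdsWithin)).exists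
    exact ⟨q, hq₀, hq₁, hq⟩
  obtain ⟨q, hq₀, hq₁, hq⟩ := hq
  have hpos : 0 < |lam j| := abs_pos.2 (hlam j)
  have hsmall₁ : ∀ᶠ p : ℕ in atTop, (∑ i, |lam i|) * q ^ p < |lam j| / 2 :=
    ((tendsto_pow_atTop_nhds_zero_of_lt_one hq₀.le hq₁).const_mul _).eventually_lt_const
      (by rw [mul_zero]; positivity)
  have hsmall₂ : ∀ᶠ p : ℕ in atTop, (∑ i, |lam i|) / q * (p * q ^ p) < |lam j| / 16 :=
    ((tendsto_self_mul_const_pow_of_lt_one hq₀.le hq₁).const_mul _).eventually_lt_const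
      (by rw [mul_zero]; positivity)
  obtain ⟨N, hN⟩ := eventually_atTop.1 (hsmall₁.and hsmall₂)
  refine ⟨N + 2, fun d hd μ hμ₀ hμ => ?_⟩
  obtain ⟨p, rfl⟩ : ∃ p, d = p + 2 := ⟨d - 2, by omega⟩
  obtain ⟨h₁, h₂⟩ := hN (p + 1) (by omega)
  rw [show p + 2 - 1 = p + 1 by omega] at hμ ⊢
  have hμabs : |lam j| / 2 ≤ |μ| := by
    have h := abs_eigenvalue_sub_le hunit lam (p + 1) hq₀.le hq₁.le hμ fun i hi => (hq i hi).le
    have h' := abs_sub_abs_le_abs_sub (lam j) μ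
    rw [abs_sub_comm] at h'
    linarith
  obtain ⟨ε, hε, hstep⟩ := exists_distUpToSign_symmetricPowerMap_le hunit lam (p + 1) hμ₀ hq₀.le
    hμ hq (by
      have : (∑ i, |lam i|) / q * (((p + 1 : ℕ) : ℝ) * q ^ (p + 1)) =
          (∑ i, |lam i|) * (((p + 1 : ℕ) : ℝ) * q ^ (p + 1 - 1)) := by
        rw [Nat.add_sub_cancel, pow_succ]
        field_simp
      linarith)
  refine ⟨ε, hε, fun x hx₀ hx => ?_⟩
  have hgeom : ∀ k, distUpToSign (v j) (x k) < ε ∧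
      distUpToSign (v j) (x k) ≤ (1 / 2) ^ k * ε := by
    intro k
    induction k with
    | zero =>
      have h : distUpToSign (v j) (x 0) < ε := (min_le_left _ _).trans_lt hx₀
      exact ⟨h, by simpa using h.le⟩
    | succ k ih =>
      have h := hstep (x k) ih.1
      have hnn := distUpToSign_nonneg (v j) (x k)
      rw [hx k]
      refine ⟨h.trans_lt (by linarith [ih.1]), h.trans ?_⟩
      rw [pow_succ]
      linarith [ih.2]
  refine squeeze_zero (fun k => distUpToSign_nonneg (v j) (x k)) (fun k => (hgeom k).2) ?_
  simpa using (tendsto_pow_atTop_nhds_zero_of_lt_one (r := (1 / 2 : ℝ)) (by norm_num)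
    (by norm_num)).mul_const ε
end

section
/- Let d ≥ 2, r ≥ 2, let v_1, …, v_r ∈ ℝ^n be unit vectors and λ_1, …, λ_r ∈ ℝ, and suppose F_d(v_j) = μ·v_j with μ ≠ 0. Let J be the linear map w ↦ ((d−1)/μ)·( Σ_{i=1}^r λ_i ⟨v_i, v_j⟩^{d−2} ⟨v_i, w⟩ v_i − μ ⟨v_j, w⟩ v_j ). Then the operator norm of J satisfies ‖J‖ ≤ |(d−1)/μ| · (r−1) · (max_{i≠j} |λ_i|) · (max_{i≠j} |⟨v_i, v_j⟩|)^{d−2}. -/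
open scoped RealInnerProductSpace

/-- Removing from a vector its component along a unit vector does not increase the norm. -/
theorem norm_sub_inner_smul_le {E : Type*} [NormedAddCommGroup E] [InnerProductSpace ℝ E]
    {x : E} (hx : ‖x‖ = 1) (w : E) : ‖w - ⟪x, w⟫ • x‖ ≤ ‖w‖ := by
  refine (sq_le_sq₀ (norm_nonneg _) (norm_nonneg _)).mp ?_
  rw [norm_sub_sq_real, inner_smul_right, real_inner_comm, norm_smul, hx, mul_one,
    Real.norm_eq_abs, sq_abs, real_inner_comm]
  nlinarith [sq_nonneg ⟪x, w⟫]

/-- A weighted sum of the rank-one maps `u ↦ ⟪v i, u⟫ • v i` with unit vectors `v i` and weights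
bounded by `C` has norm at most the number of terms times `C`. -/
theorem norm_sum_mul_inner_smul_le {E ι : Type*} [NormedAddCommGroup E] [InnerProductSpace ℝ E]
    (s : Finset ι) {v : ι → E} {c : ι → ℝ} {C : ℝ} (hv : ∀ i ∈ s, ‖v i‖ = 1)
    (hc : ∀ i ∈ s, |c i| ≤ C) (u : E) :
    ‖∑ i ∈ s, (c i * ⟪v i, u⟫) • v i‖ ≤ s.card * C * ‖u‖ := by
  rw [mul_assoc, ← nsmul_eq_mul]
  refine (norm_sum_le _ _).trans (Finset.sum_le_card_nsmul _ _ _ fun i hi => ?_)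
  rw [norm_smul, hv i hi, mul_one, Real.norm_eq_abs, abs_mul]
  have h := abs_real_inner_le_norm (v i) u
  rw [hv i hi, one_mul] at h
  exact mul_le_mul (hc i hi) h (abs_nonneg _) ((abs_nonneg _).trans (hc i hi))

/-- Bound on the operator norm (= spectral radius) of the Jacobian of the
tensor power method iteration at an eigenvector `v j`:
`‖J‖ ≤ |(d−1)/μ| ⬝ (r−1) ⬝ (max_{i≠j} |λ_i|) ⬝ (max_{i≠j} |⟨v_i, v_j⟩|)^{d−2}`. -/
theorem jacobian_operator_norm_bound {n r : ℕ} (d : ℕ) (hd : 2 ≤ d) (hr : 2 ≤ r)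
    (v : Fin r → EuclideanSpace ℝ (Fin n)) (lam : Fin r → ℝ)
    (hunit : ∀ i, ‖v i‖ = 1)
    (j : Fin r) (μ : ℝ) (hμ : μ ≠ 0)
    (heig : (∑ i, (lam i * ⟪v i, v j⟫ ^ (d - 1)) • v i) = μ • v j)
    (J : EuclideanSpace ℝ (Fin n) →L[ℝ] EuclideanSpace ℝ (Fin n))
    (hJ : ∀ w : EuclideanSpace ℝ (Fin n),
      J w = (((d : ℝ) - 1) / μ) •
        ((∑ i, (lam i * ⟪v i, v j⟫ ^ (d - 2) * ⟪v i, w⟫) • v i) -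
          (μ * ⟪v j, w⟫) • v j)) :
    ‖J‖ ≤ |((d : ℝ) - 1) / μ| * ((r : ℝ) - 1) *
        ((Finset.univ.erase j).sup'
          (Finset.card_pos.mp (by
            rw [Finset.card_erase_of_mem (Finset.mem_univ j), Finset.card_univ,
              Fintype.card_fin]; omega)) fun i => |lam i|) *
        ((Finset.univ.erase j).sup'
          (Finset.card_pos.mp (by
            rw [Finset.card_erase_of_mem (Finset.mem_univ j), Finset.card_univ,
              Fintype.card_fin]; omega)) fun i => |(⟪v i, v j⟫ : ℝ)|) ^ (d - 2) := by
  have hne : (Finset.univ.erase j).Nonempty := Finset.card_pos.mp (by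
    rw [Finset.card_erase_of_mem (Finset.mem_univ j), Finset.card_univ, Fintype.card_fin]; omega)
  set L := (Finset.univ.erase j).sup' hne fun i => |lam i|
  set M := (Finset.univ.erase j).sup' hne fun i => |(⟪v i, v j⟫ : ℝ)|
  have hlam : ∀ i ∈ Finset.univ.erase j, |lam i| ≤ L := fun i hi =>
    Finset.le_sup' (fun i => |lam i|) hi
  have hinner : ∀ i ∈ Finset.univ.erase j, |(⟪v i, v j⟫ : ℝ)| ≤ M := fun i hi =>
    Finset.le_sup' (fun i => |(⟪v i, v j⟫ : ℝ)|) hi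
  obtain ⟨k, hk⟩ := hne
  have hL0 : 0 ≤ L := (abs_nonneg _).trans (hlam k hk)
  have hM0 : 0 ≤ M := (abs_nonneg _).trans (hinner k hk)
  have hr1 : (0 : ℝ) ≤ (r : ℝ) - 1 := by
    have : (2 : ℝ) ≤ r := by exact_mod_cast hr
    linarith
  have hcoef : ∀ i ∈ Finset.univ.erase j, |lam i * ⟪v i, v j⟫ ^ (d - 2)| ≤ L * M ^ (d - 2) := by
    intro i hi
    rw [abs_mul, abs_pow]
    exact mul_le_mul (hlam i hi) (pow_le_pow_left₀ (abs_nonneg _) (hinner i hi) _)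
      (by positivity) hL0
  have hcard : ((Finset.univ.erase j).card : ℝ) = (r : ℝ) - 1 := by
    rw [Finset.card_erase_of_mem (Finset.mem_univ j), Finset.card_univ, Fintype.card_fin,
      Nat.cast_sub (by omega), Nat.cast_one]
  have hvj : (⟪v j, v j⟫ : ℝ) = 1 := by simp [hunit j]
  have hJv : J (v j) = 0 := by
    have hpow : ∀ x : ℝ, x ^ (d - 2) * x = x ^ (d - 1) := fun x => by
      rw [← pow_succ, show d - 2 + 1 = d - 1 by omega]
    simp only [hJ, mul_assoc, hpow, heig, hvj, mul_one, sub_self, smul_zero]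
  refine J.opNorm_le_bound (by positivity) fun w => ?_
  set u := w - ⟪v j, w⟫ • v j with hu
  have hJu : J w = J u := by rw [hu, map_sub, map_smul, hJv, smul_zero, sub_zero]
  have hju : (⟪v j, u⟫ : ℝ) = 0 := by
    rw [hu, inner_sub_right, inner_smul_right, hvj, mul_one, sub_self]
  rw [hJu, hJ, ← Finset.add_sum_erase _ _ (Finset.mem_univ j), hju, mul_zero, mul_zero, zero_smul,
    zero_add, sub_zero, norm_smul, Real.norm_eq_abs]
  calc |((d : ℝ) - 1) / μ| *
        ‖∑ i ∈ Finset.univ.erase j, (lam i * ⟪v i, v j⟫ ^ (d - 2) * ⟪v i, u⟫) • v i‖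
      ≤ |((d : ℝ) - 1) / μ| * (((r : ℝ) - 1) * (L * M ^ (d - 2)) * ‖w‖) := by
        gcongr
        refine (norm_sum_mul_inner_smul_le _ (fun i _ => hunit i) hcoef u).trans ?_
        rw [hcard]
        gcongr
        exact norm_sub_inner_smul_le (hunit j) w
    _ = |((d : ℝ) - 1) / μ| * ((r : ℝ) - 1) * L * M ^ (d - 2) * ‖w‖ := by ring
end

section
/- Let v_1, …, v_r ∈ ℝ^n be unit vectors and λ_1, …, λ_r ∈ ℝ, fix j, and assume |⟨v_i, v_j⟩| < 1 for all i ≠ j. Suppose that for every d ≥ 2 there is μ_d ∈ ℝ with F_d(v_j) = μ_d·v_j. Then |μ_d − λ_j| ≤ Σ_{i≠j} |λ_i| |⟨v_i, v_j⟩|^{d−1} for every d ≥ 2, and consequently μ_d → λ_j as d → ∞. -/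
open Filter
open scoped RealInnerProductSpace

/-- If `v j` is an eigenvector of `T_d = ∑ i, λ i • (v i)^{⊗d}` with
eigenvalue `μ d` for every order `d ≥ 2`, then
`|μ_d − λ_j| ≤ ∑_{i≠j} |λ_i| |⟨v_i,v_j⟩|^{d−1}` for every `d ≥ 2`, and `μ_d → λ_j`. -/
theorem eigenvalue_tendsto_coefficient {n r : ℕ}
    (v : Fin r → EuclideanSpace ℝ (Fin n)) (lam : Fin r → ℝ)
    (hunit : ∀ i, ‖v i‖ = 1) (j : Fin r)
    (hangle : ∀ i : Fin r, i ≠ j → |(⟪v i, v j⟫ : ℝ)| < 1)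
    (μ : ℕ → ℝ)
    (heig : ∀ d : ℕ, 2 ≤ d →
      (∑ i, (lam i * ⟪v i, v j⟫ ^ (d - 1)) • v i) = μ d • v j) :
    (∀ d : ℕ, 2 ≤ d →
      |μ d - lam j| ≤ ∑ i ∈ Finset.univ.erase j, |lam i| * |(⟪v i, v j⟫ : ℝ)| ^ (d - 1)) ∧
    Tendsto μ atTop (nhds (lam j)) := by
  have hself : (⟪v j, v j⟫ : ℝ) = 1 := by simp [hunit j]
  have hbound : ∀ d : ℕ, 2 ≤ d →
      |μ d - lam j| ≤ ∑ i ∈ Finset.univ.erase j, |lam i| * |(⟪v i, v j⟫ : ℝ)| ^ (d - 1) := by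
    intro d hd
    have hμ : ∑ i, lam i * (⟪v i, v j⟫ : ℝ) ^ (d - 1) * ⟪v i, v j⟫ = μ d := by
      simpa only [sum_inner, real_inner_smul_left, hself, mul_one]
        using congrArg (fun x => (⟪x, v j⟫ : ℝ)) (heig d hd)
    rw [← Finset.add_sum_erase _ _ (Finset.mem_univ j), hself, one_pow, mul_one, mul_one] at hμ
    rw [← hμ, add_sub_cancel_left]
    refine (Finset.abs_sum_le_sum_abs _ _).trans (Finset.sum_le_sum fun i hi => ?_)
    rw [abs_mul, abs_mul, abs_pow]
    exact mul_le_of_le_one_right (by positivity) (hangle i (Finset.ne_of_mem_erase hi)).le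
  refine ⟨hbound, ?_⟩
  have hlim : Tendsto (fun d : ℕ =>
      ∑ i ∈ Finset.univ.erase j, |lam i| * |(⟪v i, v j⟫ : ℝ)| ^ (d - 1)) atTop (nhds 0) := by
    rw [← Finset.sum_const_zero (M := ℝ) (s := Finset.univ.erase j)]
    refine tendsto_finsetSum _ fun i hi => ?_
    simpa using ((tendsto_pow_atTop_nhds_zero_of_lt_one (abs_nonneg _)
      (hangle i (Finset.ne_of_mem_erase hi))).comp (tendsto_sub_atTop_nat 1)).const_mul |lam i|
  rw [tendsto_iff_dist_tendsto_zero]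
  refine squeeze_zero' (Eventually.of_forall fun _ => dist_nonneg) ?_ hlim
  filter_upwards [eventually_ge_atTop 2] with d hd
  simpa only [Real.dist_eq] using hbound d hd
end

section
/- Let v_1, …, v_r ∈ ℝ^n be an equiangular set with constant α, let λ_1, …, λ_r ∈ ℝ, and let d ≥ 2. If for some j ∈ {1,…,r} there exists μ_j ∈ ℝ such that μ_j·v_j + Σ_{i≠j} λ_i σ_{ij}^{d−1} v_i = 0 (i.e. the vector (λ_1 σ_{1j}^{d−1}, …, μ_j in position j, …, λ_r σ_{rj}^{d−1}) lies in the kernel of the matrix V with columns v_1, …, v_r), then F_d(v_j) = (λ_j − α^{d−1} μ_j)·v_j; in particular v_j is an eigenvector of the tensor T = Σ_i λ_i v_i^{⊗d}. -/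
open scoped RealInnerProductSpace

/-- For a tensor generated by an equiangular set with constant `α` and
signs `σ`, if `μ_j • v_j + ∑_{i≠j} λ_i σ_{ij}^{d−1} • v_i = 0` (a kernel condition on the
matrix with columns `v_1, …, v_r`), then `F_d(v_j) = (λ_j − α^{d−1} μ_j) • v_j`, so `v_j`
is an eigenvector of `T = ∑ i, λ i • (v i)^{⊗d}`. -/
theorem eigenvector_of_kernel_condition {n r : ℕ} (d : ℕ) (hd : 2 ≤ d)
    (v : Fin r → EuclideanSpace ℝ (Fin n)) (lam : Fin r → ℝ)
    (α : ℝ) (hα : 0 ≤ α)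
    (hunit : ∀ i, ‖v i‖ = 1)
    (σ : Fin r → Fin r → ℝ)
    (hσsign : ∀ i k : Fin r, σ i k = 1 ∨ σ i k = -1)
    (hES : ∀ i k : Fin r, i ≠ k → ⟪v i, v k⟫ = σ i k * α)
    (j : Fin r) (μj : ℝ)
    (hker : μj • v j + ∑ i ∈ Finset.univ.erase j, (lam i * σ i j ^ (d - 1)) • v i = 0) :
    (∑ i, (lam i * ⟪v i, v j⟫ ^ (d - 1)) • v i) = (lam j - α ^ (d - 1) * μj) • v j := by
  have hself : ⟪v j, v j⟫ = 1 := by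
    rw [real_inner_self_eq_norm_sq, hunit j, one_pow]
  have hrest : ∑ i ∈ Finset.univ.erase j, (lam i * ⟪v i, v j⟫ ^ (d - 1)) • v i
      = α ^ (d - 1) • ∑ i ∈ Finset.univ.erase j, (lam i * σ i j ^ (d - 1)) • v i := by
    rw [Finset.smul_sum]
    refine Finset.sum_congr rfl fun i hi => ?_
    rw [hES i j (Finset.ne_of_mem_erase hi), smul_smul, mul_pow]
    congr 1
    ring
  rw [← Finset.add_sum_erase _ _ (Finset.mem_univ j), hrest, hself,
    eq_neg_of_add_eq_zero_right hker, one_pow, mul_one, smul_neg, smul_smul, sub_smul,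
    sub_eq_add_neg]
end

section
/- Let v_1, …, v_r ∈ ℝ^n be an equiangular set with constant α, let λ_1, …, λ_r ∈ ℝ, and let d ≥ 3 be odd. If Σ_{i=1}^r λ_i v_i = 0 (i.e. (λ_1, …, λ_r) lies in the kernel of the matrix V with columns v_1, …, v_r), then for every j ∈ {1,…,r} one has F_d(v_j) = λ_j (1 − α^{d−1})·v_j; in particular all of v_1, …, v_r are eigenvectors of the tensor T = Σ_i λ_i v_i^{⊗d}. -/
open scoped RealInnerProductSpace

/-- For a tensor of odd order `d ≥ 3` generated by an equiangular set
with constant `α`, if `∑ i, λ_i v_i = 0`, then `F_d(v_j) = λ_j (1 − α^{d−1}) • v_j` for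
every `j`; in particular all generating vectors are eigenvectors of
`T = ∑ i, λ i • (v i)^{⊗d}`. -/
theorem eigenvectors_of_lambdas_in_kernel_odd {n r : ℕ} (d : ℕ) (hd : 3 ≤ d) (hodd : Odd d)
    (v : Fin r → EuclideanSpace ℝ (Fin n)) (lam : Fin r → ℝ)
    (α : ℝ) (hα : 0 ≤ α)
    (hunit : ∀ i, ‖v i‖ = 1)
    (hES : ∀ i k : Fin r, i ≠ k → |(⟪v i, v k⟫ : ℝ)| = α)
    (hker : ∑ i, lam i • v i = 0) :
    ∀ j : Fin r,
      (∑ i, (lam i * ⟪v i, v j⟫ ^ (d - 1)) • v i) = (lam j * (1 - α ^ (d - 1))) • v j := by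
  intro j
  have heven : Even (d - 1) := Nat.Odd.sub_odd hodd odd_one
  have hterm : ∀ i, (lam i * ⟪v i, v j⟫ ^ (d - 1)) • v i =
      (if i = j then (lam j * (1 - α ^ (d - 1))) • v j else 0) + α ^ (d - 1) • lam i • v i := by
    intro i
    split_ifs with h
    · subst h
      rw [real_inner_self_eq_norm_sq, hunit, smul_smul, ← add_smul]
      congr 1
      ring
    · rw [← heven.pow_abs, hES i j h, zero_add, smul_smul, mul_comm]
  simp_rw [hterm, Finset.sum_add_distrib, ← Finset.smul_sum, hker]
  simp
end

section
/- Let v_1, …, v_r ∈ ℝ^n form an equiangular tight frame with constant α, and let d ≥ 4 be even. Then for every j ∈ {1,…,r}, F_d(v_j) = (1 + α^{d−2}(r/n − 1))·v_j, where F_d(x) = Σ_{i=1}^r ⟨v_i, x⟩^{d−1} v_i; in particular all of v_1, …, v_r are eigenvectors of the tensor T = Σ_{i=1}^r v_i^{⊗d}. -/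
open scoped RealInnerProductSpace

/-- For an equiangular tight frame `v_1, …, v_r` in `ℝ^n` with constant
`α` and an even order `d ≥ 4`, every frame vector is an eigenvector of
`T = ∑ i, (v i)^{⊗d}`: `F_d(v_j) = (1 + α^{d−2}(r/n − 1)) • v_j`. -/
theorem etf_frame_vectors_are_eigenvectors_even {n r : ℕ} (d : ℕ) (hd : 4 ≤ d)
    (heven : Even d)
    (v : Fin r → EuclideanSpace ℝ (Fin n))
    (α : ℝ) (hα : 0 ≤ α)
    (hunit : ∀ i, ‖v i‖ = 1)
    (hES : ∀ i k : Fin r, i ≠ k → |(⟪v i, v k⟫ : ℝ)| = α)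
    (htight : ∀ x : EuclideanSpace ℝ (Fin n),
      ∑ i, ⟪v i, x⟫ • v i = ((r : ℝ) / (n : ℝ)) • x) :
    ∀ j : Fin r,
      (∑ i, ((⟪v i, v j⟫ : ℝ) ^ (d - 1)) • v i) =
        (1 + α ^ (d - 2) * ((r : ℝ) / (n : ℝ) - 1)) • v j := by
  intro j
  have hpow : ∀ i, (⟪v i, v j⟫ : ℝ) ^ (d - 1) =
      α ^ (d - 2) * ⟪v i, v j⟫ + if i = j then 1 - α ^ (d - 2) else 0 := by
    intro i
    by_cases hij : i = j
    · subst hij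
      simp [hunit]
    · have hd2 : Even (d - 2) := heven.tsub even_two
      rw [if_neg hij, add_zero, ← hES i j hij, hd2.pow_abs, ← pow_succ]
      congr 1
      omega
  simp only [hpow, add_smul, mul_smul, Finset.sum_add_distrib, ← Finset.smul_sum, htight,
    ite_smul, zero_smul, Finset.sum_ite_eq', Finset.mem_univ, if_true]
  module
end

section
/- Let v_1, …, v_r ∈ ℝ^n form an equiangular tight frame with constant α, and let d ≥ 4 be even. If (r/n)·α^{d−2}·(d−1) < 1 + α^{d−2}(r/n − 1), then every v_j (j = 1, …, r) is a robust eigenvector of F_d, where F_d(x) = Σ_{i=1}^r ⟨v_i, x⟩^{d−1} v_i. -/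
open Filter
open scoped RealInnerProductSpace

section PowerMethod

variable {E : Type*} [NormedAddCommGroup E]

/-- A fixed point at which the derivative has operator norm less than one attracts all orbits
that start close enough to it. -/
theorem HasFDerivAt.exists_forall_tendsto_of_norm_lt_one [NormedSpace ℝ E] {G : E → E}
    {G' : E →L[ℝ] E} {p : E} (hG : HasFDerivAt G G' p) (hp : G p = p) (hG' : ‖G'‖ < 1) :
    ∃ ε > (0 : ℝ), ∀ x : ℕ → E, ‖x 0 - p‖ < ε → (∀ k, x (k + 1) = G (x k)) →
      Tendsto x atTop (nhds p) := by
  obtain ⟨c, hc, hc1⟩ := exists_between hG'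
  have hc0 : 0 ≤ c := (norm_nonneg _).trans hc.le
  have hev : ∀ᶠ y in nhds p, ‖G y - p‖ ≤ c * ‖y - p‖ := by
    filter_upwards [hG.isLittleO.def (sub_pos.2 hc)] with y hy
    rw [hp] at hy
    calc ‖G y - p‖ = ‖(G y - p - G' (y - p)) + G' (y - p)‖ := by rw [sub_add_cancel]
      _ ≤ (c - ‖G'‖) * ‖y - p‖ + ‖G'‖ * ‖y - p‖ :=
          (norm_add_le _ _).trans (add_le_add hy (G'.le_opNorm _))
      _ = c * ‖y - p‖ := by ring
  obtain ⟨ε, hε, hball⟩ := Metric.eventually_nhds_iff.1 hev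
  refine ⟨ε, hε, fun x hx0 hx => ?_⟩
  have hdecay : ∀ k, ‖x k - p‖ ≤ c ^ k * ‖x 0 - p‖ := by
    intro k
    induction k with
    | zero => simp
    | succ k ih =>
      have hlt : ‖x k - p‖ < ε :=
        (ih.trans (mul_le_of_le_one_left (norm_nonneg _) (pow_le_one₀ hc0 hc1.le))).trans_lt hx0
      rw [hx k]
      calc ‖G (x k) - p‖ ≤ c * ‖x k - p‖ := hball (by rwa [dist_eq_norm])
        _ ≤ c * (c ^ k * ‖x 0 - p‖) := by gcongr
        _ = c ^ (k + 1) * ‖x 0 - p‖ := by ring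
  rw [tendsto_iff_norm_sub_tendsto_zero]
  refine squeeze_zero (fun _ => norm_nonneg _) hdecay ?_
  simpa using (tendsto_pow_atTop_nhds_zero_of_lt_one hc0 hc1).mul_const ‖x 0 - p‖

variable [InnerProductSpace ℝ E]

/-- The derivative of `y ↦ y / ‖y‖` at a positive multiple `l • u` of a unit vector `u`. -/
theorem hasFDerivAt_inv_norm_smul {u : E} (hu : ‖u‖ = 1) {l : ℝ} (hl : 0 < l) :
    HasFDerivAt (fun y : E => ‖y‖⁻¹ • y)
      (l⁻¹ • (ContinuousLinearMap.id ℝ E - (innerSL ℝ u).smulRight u)) (l • u) := by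
  have hnorm : ‖l • u‖ = l := by rw [norm_smul, hu, mul_one, Real.norm_of_nonneg hl.le]
  have hsq : HasFDerivAt (fun y : E => ‖y‖ ^ 2) (2 • innerSL ℝ (l • u)) (l • u) :=
    (hasStrictFDerivAt_norm_sq (l • u)).hasFDerivAt
  have hsqrt := hsq.sqrt (by rw [hnorm]; positivity)
  simp only [Real.sqrt_sq (norm_nonneg _), hnorm] at hsqrt
  have hinv := (hasDerivAt_inv (x := ‖l • u‖) (by rw [hnorm]; exact hl.ne')).comp_hasFDerivAt
    (l • u) hsqrt
  have h := hinv.smul (hasFDerivAt_id (𝕜 := ℝ) (l • u))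
  refine h.congr_fderiv ?_
  ext y
  simp [hnorm, Real.sqrt_sq hl.le, smul_smul, sub_eq_add_neg]
  field_simp

theorem norm_sub_inner_smul_le_s9 {u : E} (hu : ‖u‖ = 1) (y : E) : ‖y - ⟪u, y⟫ • u‖ ≤ ‖y‖ := by
  have h : ‖y - ⟪u, y⟫ • u‖ ^ 2 = ‖y‖ ^ 2 - ⟪u, y⟫ ^ 2 := by
    rw [norm_sub_sq_real, norm_smul, inner_smul_right, real_inner_comm, hu, mul_one,
      Real.norm_eq_abs, sq_abs]
    ring
  exact le_of_sq_le_sq (by nlinarith [sq_nonneg ⟪u, y⟫]) (norm_nonneg _)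

/-- The derivative of `x ↦ ∑ i, ⟪v i, x⟫ ^ m • v i`. -/
theorem hasFDerivAt_sum_inner_pow_smul {ι : Type*} [Fintype ι] (v : ι → E) (m : ℕ) (p : E) :
    HasFDerivAt (fun x => ∑ i, (⟪v i, x⟫ ^ m) • v i)
      (∑ i, ((m * ⟪v i, p⟫ ^ (m - 1)) • innerSL ℝ (v i)).smulRight (v i)) p := by
  refine HasFDerivAt.fun_sum fun i _ => ?_
  have h := ((innerSL ℝ (v i)).hasFDerivAt (x := p)).pow m
  exact (h.smul_const (v i)).congr_fderiv (by simp)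

/-- In a tight frame with unit `v j`, reweighting the other terms by a common factor `a`. -/
theorem sum_weighted_inner_smul_of_tight {ι : Type*} [Fintype ι] {v : ι → E} {ρ a : ℝ}
    (htight : ∀ x, ∑ i, ⟪v i, x⟫ • v i = ρ • x) {j : ι} {w : ι → ℝ} (hj : w j = 1)
    (hw : ∀ i, i ≠ j → w i = a) (x : E) :
    ∑ i, (w i * ⟪v i, x⟫) • v i = (a * ρ) • x + ((1 - a) * ⟪v j, x⟫) • v j := by
  classical
  have hsum : ∑ i, ((w i - a) * ⟪v i, x⟫) • v i = ((1 - a) * ⟪v j, x⟫) • v j := by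
    rw [Finset.sum_eq_single j (fun i _ hij => by simp [hw i hij]) (by simp), hj]
  rw [← hsum, mul_smul, ← htight x, Finset.smul_sum, ← Finset.sum_add_distrib]
  refine Finset.sum_congr rfl fun i _ => ?_
  module

end PowerMethod

/-- For an equiangular tight frame with constant `α` and an even order
`d ≥ 4`, if `(r/n) α^{d−2} (d−1) < 1 + α^{d−2}(r/n − 1)`, then every frame vector `v j`
is a robust eigenvector of `F_d(x) = ∑ i, ⟨v_i, x⟩^{d−1} v_i`. -/
theorem etf_frame_vectors_robust_even {n r : ℕ} (d : ℕ) (hd : 4 ≤ d) (heven : Even d)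
    (v : Fin r → EuclideanSpace ℝ (Fin n))
    (α : ℝ) (hα : 0 ≤ α)
    (hunit : ∀ i, ‖v i‖ = 1)
    (hES : ∀ i k : Fin r, i ≠ k → |(⟪v i, v k⟫ : ℝ)| = α)
    (htight : ∀ x : EuclideanSpace ℝ (Fin n),
      ∑ i, ⟪v i, x⟫ • v i = ((r : ℝ) / (n : ℝ)) • x)
    (hbound : ((r : ℝ) / (n : ℝ)) * α ^ (d - 2) * ((d : ℝ) - 1) <
      1 + α ^ (d - 2) * ((r : ℝ) / (n : ℝ) - 1)) :
    ∀ j : Fin r, ∃ ε > (0 : ℝ), ∀ x : ℕ → EuclideanSpace ℝ (Fin n),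
      ‖x 0 - v j‖ < ε →
      (∀ k : ℕ, x (k + 1) =
        ‖∑ i, ((⟪v i, x k⟫ : ℝ) ^ (d - 1)) • v i‖⁻¹ •
          (∑ i, ((⟪v i, x k⟫ : ℝ) ^ (d - 1)) • v i)) →
      Tendsto x atTop (nhds (v j)) := by
  intro j
  obtain ⟨m, rfl⟩ : ∃ m, d = m + 2 := ⟨d - 2, by omega⟩
  have hm : Even m := by simpa [Nat.even_add] using heven
  have hexp : m + 2 - 1 = m + 1 := rfl
  simp only [Nat.add_sub_cancel, hexp] at hbound ⊢
  push_cast at hbound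
  set ρ : ℝ := (r : ℝ) / (n : ℝ) with hρ
  set l : ℝ := 1 + α ^ m * (ρ - 1) with hl
  have hρ0 : 0 ≤ ρ := by positivity
  have hnum : 0 ≤ (m + 1) * (α ^ m * ρ) := by positivity
  have hlt : (m + 1) * (α ^ m * ρ) < l := by linarith
  have hl0 : 0 < l := hnum.trans_lt hlt
  have hjj : ⟪v j, v j⟫ = 1 := by simp [hunit j]
  have hweighted := sum_weighted_inner_smul_of_tight htight (j := j)
    (w := fun i => ⟪v i, v j⟫ ^ m) (a := α ^ m) (by simp [hunit j])
    (fun i hij => by rw [← hES i j hij, hm.pow_abs])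
  have heig : ∑ i, (⟪v i, v j⟫ ^ (m + 1)) • v i = l • v j := by
    simp only [pow_succ, hweighted, hjj, hl]
    module
  have hF := hasFDerivAt_sum_inner_pow_smul v (m + 1) (v j)
  have hN := hasFDerivAt_inv_norm_smul (hunit j) hl0
  rw [← heig] at hN
  refine (hN.comp (v j) hF).exists_forall_tendsto_of_norm_lt_one ?_ ?_
  · simp only [Function.comp_apply, heig, norm_smul, hunit j, Real.norm_of_nonneg hl0.le, mul_one,
      smul_smul, inv_mul_cancel₀ hl0.ne', one_smul]
  · refine (ContinuousLinearMap.opNorm_le_bound _ (M := l⁻¹ * ((m + 1) * (α ^ m * ρ)))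
      (by positivity) fun y => ?_).trans_lt (by rwa [inv_mul_lt_one₀ hl0])
    have hFy : (∑ i, (((m + 1 : ℕ) * ⟪v i, v j⟫ ^ (m + 1 - 1)) • innerSL ℝ (v i)).smulRight
        (v i)) y = ((m : ℝ) + 1) • ((α ^ m * ρ) • y + ((1 - α ^ m) * ⟪v j, y⟫) • v j) := by
      rw [← hweighted y, Finset.smul_sum]
      simp [smul_smul, mul_assoc]
    have hy : (l⁻¹ • (ContinuousLinearMap.id ℝ (EuclideanSpace ℝ (Fin n)) -
        (innerSL ℝ (v j)).smulRight (v j)))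
        (((m : ℝ) + 1) • ((α ^ m * ρ) • y + ((1 - α ^ m) * ⟪v j, y⟫) • v j)) =
        (l⁻¹ * ((m + 1) * (α ^ m * ρ))) • (y - ⟪v j, y⟫ • v j) := by
      simp only [smul_apply, sub_apply, ContinuousLinearMap.id_apply,
        ContinuousLinearMap.smulRight_apply, innerSL_apply_apply, inner_smul_right, inner_add_right, hjj]
      module
    rw [ContinuousLinearMap.comp_apply, hFy, hy, norm_smul, Real.norm_of_nonneg (by positivity)]
    gcongr
    exact norm_sub_inner_smul_le_s9 (hunit j) y
end

section
/- Let v_1, v_2, v_3 ∈ ℝ² form a regular 2-simplex frame, let d ≥ 6 be even, and let F_d(x) = Σ_{i=1}^3 ⟨v_i, x⟩^{d−1} v_i. Let x_0 ∈ ℝ² and suppose there is a unique v in the set S = {v_1, −v_1, v_2, −v_2, v_3, −v_3} maximizing ⟨v, x_0⟩, i.e. ⟨v, x_0⟩ > ⟨w, x_0⟩ for all w ∈ S with w ≠ v. Then the tensor power method iterates x_{k+1} = F_d(x_k)/‖F_d(x_k)‖ starting from x_0 are well defined (F_d(x_k) ≠ 0 for all k) and converge to v. -/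
open Filter
open scoped RealInnerProductSpace

section Scalar

/-- Quantitative form of `3 (p ^ m - q ^ m) ≤ (p - q) (2 + p ^ m + q ^ m)` for `p + q = 1`. -/
lemma three_mul_pow_sub_pow_le {p q : ℝ} (hq : 0 < q) (hpq : q ≤ p) (h1 : p + q = 1)
    {m : ℕ} (hm : 4 ≤ m) :
    3 * (p ^ m - q ^ m) ≤ (p - q) * (2 + p ^ m + q ^ m) - (p - q) * (2 * (p * q)) := by
  have hp : 0 < p := hq.trans_le hpq
  induction m, hm using Nat.le_induction with
  | base =>
    obtain rfl : p = 1 - q := by linarith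
    have : 0 ≤ (1 - q - q) * ((1 - q) * q) ^ 2 := by
      apply mul_nonneg <;> nlinarith [sq_nonneg ((1 - q) * q)]
    nlinarith
  | succ n hn ih =>
    obtain ⟨j, rfl⟩ : ∃ j, n = j + 2 := ⟨n - 2, by omega⟩
    have hpow : q ^ j ≤ p ^ j := pow_le_pow_left₀ hq.le hpq j
    have hqj : 0 < q ^ j := pow_pos hq j
    have hkey : (p - q) * (p ^ (j + 1) + q ^ (j + 1)) ≤ 3 * (p ^ (j + 1) - q ^ (j + 1)) := by
      have hc : 0 ≤ p * (3 - p + q) := mul_nonneg hp.le (by linarith)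
      have h2 := mul_le_mul_of_nonneg_right hpow hc
      have h3 : 0 ≤ q ^ j * (2 * (p - q)) := mul_nonneg hqj.le (by linarith)
      have h4 : p * (3 - p + q) - q * (3 + p - q) = 2 * (p - q) := by
        obtain rfl : p = 1 - q := by linarith
        ring
      rw [pow_succ, pow_succ]
      have h5 : q ^ j * (p * (3 - p + q)) - q ^ j * (q * (3 + p - q)) = q ^ j * (2 * (p - q)) := by
        rw [← mul_sub, h4]
      linarith
    have hmul := mul_le_mul_of_nonneg_left hkey (mul_pos hp hq).le
    obtain rfl : p = 1 - q := by linarith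
    ring_nf at ih hmul ⊢
    linarith

/-- The contraction estimate for the ratio of one power iteration step. -/
lemma ratio_step_le {p q : ℝ} (hp : 0 < p) (hq : 0 < q) {m : ℕ} (hm : 4 ≤ m) :
    3 * |p ^ m - q ^ m| / (2 * (p + q) ^ m + p ^ m + q ^ m) ≤
      |p - q| / (p + q) * (1 - (1 - (|p - q| / (p + q)) ^ 2) / 6) := by
  wlog hpq : q ≤ p generalizing p q
  · have := this hq hp (le_of_not_ge hpq)
    rw [abs_sub_comm (p ^ m), abs_sub_comm p, add_comm p q, add_right_comm]
    exact this
  rw [abs_of_nonneg (sub_nonneg.2 (pow_le_pow_left₀ hq.le hpq m)),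
    abs_of_nonneg (sub_nonneg.2 hpq)]
  obtain ⟨s, hs⟩ : ∃ s, s = p + q := ⟨_, rfl⟩
  have hs0 : 0 < s := by linarith
  obtain ⟨a, rfl⟩ : ∃ a, p = s * a := ⟨p / s, by field_simp⟩
  obtain ⟨b, rfl⟩ : ∃ b, q = s * b := ⟨q / s, by field_simp⟩
  have ha : 0 < a := pos_of_mul_pos_right hp hs0.le
  have hb : 0 < b := pos_of_mul_pos_right hq hs0.le
  have hab : b ≤ a := le_of_mul_le_mul_left hpq hs0
  have h1 : a + b = 1 := by
    apply mul_left_cancel₀ hs0.ne'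
    linarith
  have hratio : (s * a - s * b) / (s * a + s * b) = a - b := by
    rw [← hs]; field_simp
  rw [hratio, ← hs, mul_pow, mul_pow]
  have hsm : 0 < s ^ m := pow_pos hs0 m
  have ham : 0 < a ^ m := pow_pos ha m
  have hbm : 0 < b ^ m := pow_pos hb m
  have hle : a ^ m + b ^ m ≤ 1 := by
    have h2 : a ^ m ≤ a := pow_le_of_le_one ha.le (by linarith) (by omega)
    have h3 : b ^ m ≤ b := pow_le_of_le_one hb.le (by linarith) (by omega)
    linarith
  have hfac : 3 * (s ^ m * a ^ m - s ^ m * b ^ m) / (2 * s ^ m + s ^ m * a ^ m + s ^ m * b ^ m)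
      = 3 * (a ^ m - b ^ m) / (2 + a ^ m + b ^ m) := by
    field_simp
  rw [hfac, div_le_iff₀ (by positivity)]
  have hmain := three_mul_pow_sub_pow_le hb hab h1 hm
  have hnn : 0 ≤ (a - b) * (a * b) * (1 - (a ^ m + b ^ m)) :=
    mul_nonneg (mul_nonneg (by linarith) (by positivity)) (by linarith)
  have h4 : 1 - (a - b) ^ 2 = 4 * (a * b) := by
    obtain rfl : a = 1 - b := by linarith
    ring
  rw [h4]
  nlinarith

lemma tendsto_zero_of_le_mul_cubic {t : ℕ → ℝ} (h0 : ∀ k, 0 ≤ t k) (h1 : t 0 < 1)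
    (hstep : ∀ k, t (k + 1) ≤ t k * (1 - (1 - t k ^ 2) / 6)) :
    Tendsto t atTop (nhds 0) := by
  have hr0 : 0 ≤ 1 - (1 - t 0 ^ 2) / 6 := by nlinarith [sq_nonneg (t 0)]
  have hr1 : 1 - (1 - t 0 ^ 2) / 6 < 1 := by nlinarith [h0 0]
  have hbound : ∀ k, t k ≤ t 0 * (1 - (1 - t 0 ^ 2) / 6) ^ k := by
    intro k
    induction k with
    | zero => simp
    | succ k ih =>
      have hk : t k ≤ t 0 :=
        ih.trans (mul_le_of_le_one_right (h0 0) (pow_le_one₀ hr0 hr1.le))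
      have hsq : t k ^ 2 ≤ t 0 ^ 2 := pow_le_pow_left₀ (h0 k) hk 2
      calc t (k + 1) ≤ t k * (1 - (1 - t k ^ 2) / 6) := hstep k
        _ ≤ t k * (1 - (1 - t 0 ^ 2) / 6) :=
            mul_le_mul_of_nonneg_left (by linarith) (h0 k)
        _ ≤ t 0 * (1 - (1 - t 0 ^ 2) / 6) ^ k * (1 - (1 - t 0 ^ 2) / 6) :=
            mul_le_mul_of_nonneg_right ih hr0
        _ = t 0 * (1 - (1 - t 0 ^ 2) / 6) ^ (k + 1) := by ring
  refine squeeze_zero h0 hbound ?_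
  simpa using (tendsto_pow_atTop_nhds_zero_of_lt_one hr0 hr1).const_mul (t 0)

end Scalar

section Frame

variable {E : Type*} [NormedAddCommGroup E] [InnerProductSpace ℝ E]

/-- Three unit vectors with pairwise inner products `-1/2`. -/
structure IsSimplexTriple (e f g : E) : Prop where
  norm_fst : ‖e‖ = 1
  norm_snd : ‖f‖ = 1
  norm_trd : ‖g‖ = 1
  inner_fst_snd : ⟪e, f⟫ = -(1 / 2 : ℝ)
  inner_fst_trd : ⟪e, g⟫ = -(1 / 2 : ℝ)
  inner_snd_trd : ⟪f, g⟫ = -(1 / 2 : ℝ)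

/-- The contraction of the tensor `e^⊗(m+1) + f^⊗(m+1) + g^⊗(m+1)` with `x^m`. -/
noncomputable def tripleContraction (m : ℕ) (e f g x : E) : E :=
  (⟪e, x⟫ : ℝ) ^ m • e + (⟪f, x⟫ : ℝ) ^ m • f + (⟪g, x⟫ : ℝ) ^ m • g

namespace IsSimplexTriple

variable {e f g : E}

lemma neg (h : IsSimplexTriple e f g) : IsSimplexTriple (-e) (-f) (-g) := by
  obtain ⟨h1, h2, h3, h4, h5, h6⟩ := h
  constructor <;> simp only [norm_neg, inner_neg_neg, *]

lemma ne_neg (h : IsSimplexTriple e f g) : -f ≠ e ∧ -g ≠ e := by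
  have h1 : ⟪e, e⟫ = (1 : ℝ) := by rw [real_inner_self_eq_norm_sq, h.norm_fst]; norm_num
  constructor <;> intro he
  · have := h.inner_fst_snd
    rw [← neg_eq_iff_eq_neg.2 he.symm, inner_neg_right, h1] at this
    norm_num at this
  · have := h.inner_fst_trd
    rw [← neg_eq_iff_eq_neg.2 he.symm, inner_neg_right, h1] at this
    norm_num at this

lemma inner_smul_combination (h : IsSimplexTriple e f g) (α β γ : ℝ) :
    ⟪e, α • e + β • f + γ • g⟫ = α - β / 2 - γ / 2 ∧
    ⟪f, α • e + β • f + γ • g⟫ = β - α / 2 - γ / 2 ∧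
    ⟪g, α • e + β • f + γ • g⟫ = γ - α / 2 - β / 2 := by
  have h4 := real_inner_comm e f
  have h5 := real_inner_comm e g
  have h6 := real_inner_comm f g
  rw [h.inner_fst_snd] at h4
  rw [h.inner_fst_trd] at h5
  rw [h.inner_snd_trd] at h6
  simp only [inner_add_right, real_inner_smul_right, real_inner_self_eq_norm_sq, h.norm_fst,
    h.norm_snd, h.norm_trd, h.inner_fst_snd, h.inner_fst_trd, h.inner_snd_trd, h4, h5, h6]
  refine ⟨?_, ?_, ?_⟩ <;> ring

lemma norm_sq_smul_combination (h : IsSimplexTriple e f g) (α β γ : ℝ) :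
    3 * ‖α • e + β • f + γ • g‖ ^ 2 =
      2 * (⟪e, α • e + β • f + γ • g⟫ ^ 2 + ⟪f, α • e + β • f + γ • g⟫ ^ 2 +
        ⟪g, α • e + β • f + γ • g⟫ ^ 2) := by
  obtain ⟨he, hf, hg⟩ := h.inner_smul_combination α β γ
  have hnorm : ‖α • e + β • f + γ • g‖ ^ 2 =
      α * (α - β / 2 - γ / 2) + β * (β - α / 2 - γ / 2) + γ * (γ - α / 2 - β / 2) := by
    rw [← real_inner_self_eq_norm_sq]
    nth_rewrite 1 [inner_add_left]
    rw [inner_add_left, real_inner_smul_left, real_inner_smul_left, real_inner_smul_left,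
      he, hf, hg]
  rw [hnorm, he, hf, hg]
  ring

lemma inner_fst_eq (h : IsSimplexTriple e f g) (x : E) : ⟪e, x⟫ = -⟪f, x⟫ + -⟪g, x⟫ := by
  have hsum : e + f + g = 0 := by
    have := h.norm_sq_smul_combination 1 1 1
    obtain ⟨he, hf, hg⟩ := h.inner_smul_combination 1 1 1
    rw [he, hf, hg] at this
    norm_num at this
    exact this
  have : ⟪e + f + g, x⟫ = 0 := by rw [hsum, inner_zero_left]
  rw [inner_add_left, inner_add_left] at this
  linarith

/-- The relative distance from the axis spanned by `e`. -/
noncomputable def ratio (f g x : E) : ℝ :=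
  |-⟪f, x⟫ - -⟪g, x⟫| / (-⟪f, x⟫ + -⟪g, x⟫)

lemma ratio_smul (f g x : E) {c : ℝ} (hc : 0 < c) : ratio f g (c • x) = ratio f g x := by
  simp only [ratio, real_inner_smul_right, ← mul_neg, ← mul_sub, ← mul_add, abs_mul,
    abs_of_pos hc]
  exact mul_div_mul_left _ _ hc.ne'

lemma contraction_step (h : IsSimplexTriple e f g) {m : ℕ} (hm : 4 ≤ m) (hodd : Odd m) {x : E}
    (hf : ⟪f, x⟫ < 0) (hg : ⟪g, x⟫ < 0) :
    ⟪f, tripleContraction m e f g x⟫ < 0 ∧ ⟪g, tripleContraction m e f g x⟫ < 0 ∧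
      ratio f g (tripleContraction m e f g x) ≤
        ratio f g x * (1 - (1 - ratio f g x ^ 2) / 6) := by
  obtain ⟨p, hp⟩ : ∃ p, p = -⟪f, x⟫ := ⟨_, rfl⟩
  obtain ⟨q, hq⟩ : ∃ q, q = -⟪g, x⟫ := ⟨_, rfl⟩
  have hp0 : 0 < p := by linarith
  have hq0 : 0 < q := by linarith
  have hex : ⟪e, x⟫ = p + q := by rw [h.inner_fst_eq, hp, hq]
  have hfx : ⟪f, x⟫ = -p := by linarith
  have hgx : ⟪g, x⟫ = -q := by linarith
  obtain ⟨-, h2, h3⟩ := h.inner_smul_combination ((p + q) ^ m) (-p ^ m) (-q ^ m)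
  have hF : tripleContraction m e f g x = (p + q) ^ m • e + (-p ^ m) • f + (-q ^ m) • g := by
    rw [tripleContraction, hex, hfx, hgx, hodd.neg_pow, hodd.neg_pow]
  have hpm : 0 < p ^ m := pow_pos hp0 m
  have hqm : 0 < q ^ m := pow_pos hq0 m
  have hpq1 : p ^ m < (p + q) ^ m := pow_lt_pow_left₀ (by linarith) hp0.le (by omega)
  have hpq2 : q ^ m < (p + q) ^ m := pow_lt_pow_left₀ (by linarith) hq0.le (by omega)
  refine ⟨by rw [hF, h2]; linarith, by rw [hF, h3]; linarith, ?_⟩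
  have hr : ratio f g x = |p - q| / (p + q) := by rw [ratio, hp, hq]
  have hrF : ratio f g (tripleContraction m e f g x) =
      3 * |p ^ m - q ^ m| / (2 * (p + q) ^ m + p ^ m + q ^ m) := by
    rw [ratio, hF, h2, h3,
      show -(-p ^ m - (p + q) ^ m / 2 - -q ^ m / 2) - -(-q ^ m - (p + q) ^ m / 2 - -p ^ m / 2)
        = 3 / 2 * (p ^ m - q ^ m) by ring, abs_mul, abs_of_pos (by norm_num : (0 : ℝ) < 3 / 2),
      show -(-p ^ m - (p + q) ^ m / 2 - -q ^ m / 2) + -(-q ^ m - (p + q) ^ m / 2 - -p ^ m / 2)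
        = (2 * (p + q) ^ m + p ^ m + q ^ m) / 2 by ring]
    field_simp
  rw [hrF, hr]
  exact ratio_step_le hp0 hq0 hm

lemma norm_sub_sq_le (h : IsSimplexTriple e f g) {x : E} (hx : ‖x‖ = 1)
    (hframe : 3 * ‖x‖ ^ 2 = 2 * (⟪e, x⟫ ^ 2 + ⟪f, x⟫ ^ 2 + ⟪g, x⟫ ^ 2))
    (hf : ⟪f, x⟫ < 0) (hg : ⟪g, x⟫ < 0) : ‖x - e‖ ^ 2 ≤ ratio f g x ^ 2 := by
  have hs : 0 < -⟪f, x⟫ + -⟪g, x⟫ := by linarith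
  have hs1 : -⟪f, x⟫ + -⟪g, x⟫ ≤ 1 := by
    rw [← h.inner_fst_eq]
    simpa [hx, h.norm_fst] using real_inner_le_norm e x
  rw [norm_sub_sq_real, real_inner_comm, hx, h.norm_fst, h.inner_fst_eq, ratio, div_pow, sq_abs,
    le_div_iff₀ (by positivity)]
  rw [hx, h.inner_fst_eq] at hframe
  generalize ⟪f, x⟫ = a at *
  generalize ⟪g, x⟫ = b at *
  obtain ⟨s, rfl⟩ : ∃ s, a = -s - b := ⟨-a - b, by ring⟩
  have hs' : 0 < s := by linarith
  have hs1' : s ≤ 1 := by linarith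
  have hd : (-(-s - b) - -b) ^ 2 = 3 - 3 * s ^ 2 := by linear_combination -hframe
  rw [hd]
  nlinarith [mul_nonneg (sub_nonneg.2 hs1') hs'.le,
    mul_nonneg (mul_nonneg (sub_nonneg.2 hs1') hs'.le) hs'.le]

/-- Convergence of the power iteration in the cone where `⟪f, ·⟫` and `⟪g, ·⟫` are negative. -/
theorem tendsto_power_iteration (h : IsSimplexTriple e f g) {m : ℕ} (hm : 4 ≤ m)
    (hodd : Odd m) {x : ℕ → E} (hf : ⟪-f, x 0⟫ < ⟪e, x 0⟫) (hg : ⟪-g, x 0⟫ < ⟪e, x 0⟫)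
    (hiter : ∀ k, x (k + 1) =
      ‖tripleContraction m e f g (x k)‖⁻¹ • tripleContraction m e f g (x k)) :
    (∀ k, tripleContraction m e f g (x k) ≠ 0) ∧ Tendsto x atTop (nhds e) := by
  have hne : ∀ y, ⟪f, tripleContraction m e f g y⟫ < 0 → tripleContraction m e f g y ≠ 0 := by
    intro y hy h0
    simp [h0] at hy
  have hneg : ∀ k, ⟪f, x k⟫ < 0 ∧ ⟪g, x k⟫ < 0 := by
    intro k
    induction k with
    | zero =>
      rw [inner_neg_left, h.inner_fst_eq] at hf hg
      constructor <;> linarith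
    | succ k ih =>
      obtain ⟨h1, h2, -⟩ := h.contraction_step hm hodd ih.1 ih.2
      have hc : 0 < ‖tripleContraction m e f g (x k)‖⁻¹ :=
        inv_pos.2 (norm_pos_iff.2 (hne _ h1))
      rw [hiter, real_inner_smul_right, real_inner_smul_right]
      exact ⟨mul_neg_of_pos_of_neg hc h1, mul_neg_of_pos_of_neg hc h2⟩
  have hstep k := h.contraction_step hm hodd (hneg k).1 (hneg k).2
  have hF k := hne _ (hstep k).1
  refine ⟨hF, ?_⟩
  have hratio : Tendsto (fun k => ratio f g (x k)) atTop (nhds 0) := by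
    refine tendsto_zero_of_le_mul_cubic (fun k => ?_) ?_ (fun k => ?_)
    · exact div_nonneg (abs_nonneg _) (by linarith [(hneg k).1, (hneg k).2])
    · obtain ⟨h1, h2⟩ := hneg 0
      rw [ratio, div_lt_one (by linarith), abs_lt]
      constructor <;> linarith
    · rw [hiter, ratio_smul _ _ _ (inv_pos.2 (norm_pos_iff.2 (hF k)))]
      exact (hstep k).2.2
  rw [← tendsto_add_atTop_iff_nat 1, tendsto_iff_norm_sub_tendsto_zero]
  refine squeeze_zero (fun _ => norm_nonneg _) (fun k => ?_) ((tendsto_add_atTop_iff_nat 1).2 hratio)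
  have hr0 : 0 ≤ ratio f g (x (k + 1)) :=
    div_nonneg (abs_nonneg _) (by linarith [(hneg (k + 1)).1, (hneg (k + 1)).2])
  refine le_of_sq_le_sq ?_ hr0
  refine h.norm_sub_sq_le ?_ ?_ (hneg _).1 (hneg _).2
  · rw [hiter, norm_smul, norm_inv, norm_norm, inv_mul_cancel₀ (norm_ne_zero_iff.2 (hF k))]
  · have := h.norm_sq_smul_combination (⟪e, x k⟫ ^ m) (⟪f, x k⟫ ^ m) (⟪g, x k⟫ ^ m)
    rw [← tripleContraction] at this
    rw [hiter, norm_smul, real_inner_smul_right, real_inner_smul_right, real_inner_smul_right,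
      norm_inv, norm_norm]
    linear_combination (‖tripleContraction m e f g (x k)‖⁻¹) ^ 2 * this

end IsSimplexTriple

lemma tripleContraction_neg {m : ℕ} (hodd : Odd m) (e f g x : E) :
    tripleContraction m (-e) (-f) (-g) x = tripleContraction m e f g x := by
  simp [tripleContraction, hodd.neg_pow]

end Frame

/-- For a regular 2-simplex (Mercedes-Benz-type) frame `v₁, v₂, v₃` in
`ℝ²` and an even order `d ≥ 6`: if the initializing vector `x₀` has a unique maximizer
`v` of `⟨·, x₀⟩` among `{±v₁, ±v₂, ±v₃}`, then the tensor power method starting at `x₀`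
is well defined and converges to `v`. -/
theorem regular_two_simplex_convergence (d : ℕ) (hd : 6 ≤ d) (heven : Even d)
    (v' : Fin 3 → EuclideanSpace ℝ (Fin 2))
    (hunit : ∀ i, ‖v' i‖ = 1)
    (hsimplex : ∀ i k : Fin 3, i ≠ k → ⟪v' i, v' k⟫ = -(1 / 2 : ℝ))
    (x₀ : EuclideanSpace ℝ (Fin 2))
    (v : EuclideanSpace ℝ (Fin 2))
    (hv : v ∈ ({v' 0, -v' 0, v' 1, -v' 1, v' 2, -v' 2} :
      Set (EuclideanSpace ℝ (Fin 2))))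
    (hmax : ∀ w ∈ ({v' 0, -v' 0, v' 1, -v' 1, v' 2, -v' 2} :
      Set (EuclideanSpace ℝ (Fin 2))), w ≠ v → ⟪w, x₀⟫ < ⟪v, x₀⟫)
    (x : ℕ → EuclideanSpace ℝ (Fin 2))
    (hx0 : x 0 = x₀)
    (hiter : ∀ k : ℕ, x (k + 1) =
      ‖∑ i, ((⟪v' i, x k⟫ : ℝ) ^ (d - 1)) • v' i‖⁻¹ •
        (∑ i, ((⟪v' i, x k⟫ : ℝ) ^ (d - 1)) • v' i)) :
    (∀ k : ℕ, (∑ i, ((⟪v' i, x k⟫ : ℝ) ^ (d - 1)) • v' i) ≠ 0) ∧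
    Tendsto x atTop (nhds v) := by
  have hodd : Odd (d - 1) := Nat.Even.sub_odd (by omega) heven odd_one
  have hm : 4 ≤ d - 1 := by omega
  have htriple : ∀ i j k : Fin 3, i ≠ j → i ≠ k → j ≠ k →
      IsSimplexTriple (v' i) (v' j) (v' k) := fun i j k hij hik hjk =>
    ⟨hunit i, hunit j, hunit k, hsimplex i j hij, hsimplex i k hik, hsimplex j k hjk⟩
  have key : ∀ e f g : EuclideanSpace ℝ (Fin 2), IsSimplexTriple e f g → v = e →
      -f ∈ ({v' 0, -v' 0, v' 1, -v' 1, v' 2, -v' 2} : Set (EuclideanSpace ℝ (Fin 2))) →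
      -g ∈ ({v' 0, -v' 0, v' 1, -v' 1, v' 2, -v' 2} : Set (EuclideanSpace ℝ (Fin 2))) →
      (∀ y, ∑ i, ((⟪v' i, y⟫ : ℝ) ^ (d - 1)) • v' i = tripleContraction (d - 1) e f g y) →
      (∀ k : ℕ, (∑ i, ((⟪v' i, x k⟫ : ℝ) ^ (d - 1)) • v' i) ≠ 0) ∧
        Tendsto x atTop (nhds v) := by
    rintro e f g h rfl hf hg hsum
    simp only [hsum] at hiter ⊢
    subst hx0
    exact h.tendsto_power_iteration hm hodd (hmax _ hf h.ne_neg.1) (hmax _ hg h.ne_neg.2) hiter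
  have h012 := htriple 0 1 2 (by decide) (by decide) (by decide)
  have h102 := htriple 1 0 2 (by decide) (by decide) (by decide)
  have h201 := htriple 2 0 1 (by decide) (by decide) (by decide)
  have hsum : ∀ y, ∑ i, ((⟪v' i, y⟫ : ℝ) ^ (d - 1)) • v' i =
      tripleContraction (d - 1) (v' 0) (v' 1) (v' 2) y := fun y => Fin.sum_univ_three _
  have hsum1 : ∀ y, ∑ i, ((⟪v' i, y⟫ : ℝ) ^ (d - 1)) • v' i =
      tripleContraction (d - 1) (v' 1) (v' 0) (v' 2) y := fun y => by
    rw [hsum, tripleContraction, tripleContraction]; abel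
  have hsum2 : ∀ y, ∑ i, ((⟪v' i, y⟫ : ℝ) ^ (d - 1)) • v' i =
      tripleContraction (d - 1) (v' 2) (v' 0) (v' 1) y := fun y => by
    rw [hsum, tripleContraction, tripleContraction]; abel
  have hv_cases := hv
  simp only [Set.mem_insert_iff, Set.mem_singleton_iff] at hv_cases
  rcases hv_cases with h | h | h | h | h | h
  · exact key _ _ _ h012 h (by simp) (by simp) hsum
  · exact key _ _ _ h012.neg h (by simp) (by simp)
      fun y => (hsum y).trans (tripleContraction_neg hodd _ _ _ _).symm
  · exact key _ _ _ h102 h (by simp) (by simp) hsum1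
  · exact key _ _ _ h102.neg h (by simp) (by simp)
      fun y => (hsum1 y).trans (tripleContraction_neg hodd _ _ _ _).symm
  · exact key _ _ _ h201 h (by simp) (by simp) hsum2
  · exact key _ _ _ h201.neg h (by simp) (by simp)
      fun y => (hsum2 y).trans (tripleContraction_neg hodd _ _ _ _).symm
end

section
/- Let v_1, v_2, v_3 ∈ ℝ² form a regular 2-simplex frame. Then for every x ∈ ℝ², Σ_{i=1}^3 ⟨v_i, x⟩³ v_i = (9/8)·‖x‖²·x. Consequently, for the order-4 tensor T = Σ_{i=1}^3 v_i^{⊗4}, every nonzero initializing vector x is a fixed point of the tensor power method: F_4(x)/‖F_4(x)‖ = x/‖x‖. -/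
open scoped RealInnerProductSpace

/-- For unit vectors `(a, b)`, `(c, d)` at angle `2π/3`, the first coordinate of the cubic
simplex-frame map at `(p, q)`. -/
lemma simplex_frame_cubic_coord {a b c d p q : ℝ} (hab : a ^ 2 + b ^ 2 = 1)
    (hcd : c ^ 2 + d ^ 2 = 1) (hac : a * c + b * d = -(1 / 2)) :
    (a * p + b * q) ^ 3 * a + (c * p + d * q) ^ 3 * c
      + ((-a - c) * p + (-b - d) * q) ^ 3 * (-a - c) = 9 / 8 * (p ^ 2 + q ^ 2) * p := by
  obtain ⟨w, hw⟩ : ∃ w, w = a * d - b * c := ⟨_, rfl⟩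
  obtain ⟨s, hs⟩ : ∃ s, s = a * p + b * q := ⟨_, rfl⟩
  obtain ⟨t, ht⟩ : ∃ t, t = a * q - b * p := ⟨_, rfl⟩
  have hw2 : w ^ 2 = 3 / 4 := by
    have : w ^ 2 = (a ^ 2 + b ^ 2) * (c ^ 2 + d ^ 2) - (a * c + b * d) ^ 2 := by rw [hw]; ring
    rw [this, hab, hcd, hac]; norm_num
  have hc : c = -a / 2 - w * b := by
    rw [hw]; linear_combination (-c) * hab + a * hac
  have hp : p = a * s - b * t := by
    rw [hs, ht]; linear_combination (-p) * hab
  have hcx : c * p + d * q = -s / 2 + w * t := by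
    rw [hs, hw, ht]
    linear_combination (-(c * p + d * q)) * hab + (a * p + b * q) * hac
  have hn : p ^ 2 + q ^ 2 = s ^ 2 + t ^ 2 := by
    rw [hs, ht]; linear_combination (-(p ^ 2 + q ^ 2)) * hab
  have hex : (-a - c) * p + (-b - d) * q = -s / 2 - w * t := by
    linear_combination hs - hcx
  rw [hn, hex, hcx, ← hs, hc, hp]
  linear_combination
    (3 / 2 * s * t ^ 2 * a - 3 / 2 * s ^ 2 * t * b - 2 * t ^ 3 * b * (w ^ 2 + 3 / 4)) * hw2

/-- For a regular 2-simplex frame `v₁, v₂, v₃` in `ℝ²`,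
`∑ i, ⟨v_i, x⟩³ v_i = (9/8)‖x‖² x` for every `x`; hence for the order-4 simplex tensor
every nonzero initializing vector is a fixed point of the tensor power method. -/
theorem regular_two_simplex_order_four_identity
    (v : Fin 3 → EuclideanSpace ℝ (Fin 2))
    (hunit : ∀ i, ‖v i‖ = 1)
    (hsimplex : ∀ i k : Fin 3, i ≠ k → ⟪v i, v k⟫ = -(1 / 2 : ℝ)) :
    (∀ x : EuclideanSpace ℝ (Fin 2),
      ∑ i, ((⟪v i, x⟫ : ℝ) ^ 3) • v i = ((9 / 8 : ℝ) * ‖x‖ ^ 2) • x) ∧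
    (∀ x : EuclideanSpace ℝ (Fin 2), x ≠ 0 →
      ‖∑ i, ((⟪v i, x⟫ : ℝ) ^ 3) • v i‖⁻¹ • (∑ i, ((⟪v i, x⟫ : ℝ) ^ 3) • v i) =
        ‖x‖⁻¹ • x) := by
  have hsum : v 2 = -v 0 - v 1 := by
    have h : ‖v 0 + v 1 + v 2‖ ^ 2 = 0 := by
      rw [norm_add_sq_real, norm_add_sq_real, inner_add_left, hunit, hunit, hunit,
        hsimplex 0 1 (by decide), hsimplex 0 2 (by decide), hsimplex 1 2 (by decide)]
      norm_num
    have h' : v 0 + v 1 + v 2 = 0 := norm_eq_zero.mp (pow_eq_zero_iff two_ne_zero |>.mp h)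
    rw [eq_neg_of_add_eq_zero_right h']
    abel
  have hunit_coord (i : Fin 3) : v i 0 ^ 2 + v i 1 ^ 2 = 1 := by
    have h := EuclideanSpace.real_norm_sq_eq (v i)
    rw [hunit, Fin.sum_univ_two] at h
    linarith
  have hinner_coord (x y : EuclideanSpace ℝ (Fin 2)) : ⟪x, y⟫ = x 0 * y 0 + x 1 * y 1 := by
    simp [PiLp.inner_apply, Fin.sum_univ_two, mul_comm]
  have h01 : v 0 0 * v 1 0 + v 0 1 * v 1 1 = -(1 / 2) := by
    rw [← hinner_coord, hsimplex 0 1 (by decide)]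
  have hcubic (x : EuclideanSpace ℝ (Fin 2)) :
      ∑ i, ((⟪v i, x⟫ : ℝ) ^ 3) • v i = ((9 / 8 : ℝ) * ‖x‖ ^ 2) • x := by
    rw [EuclideanSpace.real_norm_sq_eq, Fin.sum_univ_two, Fin.sum_univ_three, hsum]
    simp only [hinner_coord]
    ext j
    fin_cases j
    · simpa using simplex_frame_cubic_coord (p := x 0) (q := x 1)
        (hunit_coord 0) (hunit_coord 1) h01
    · have h := simplex_frame_cubic_coord (p := x 1) (q := x 0)
        (add_comm _ _ |>.trans (hunit_coord 0)) (add_comm _ _ |>.trans (hunit_coord 1))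
        (add_comm _ _ |>.trans h01)
      simp
      linear_combination h
  refine ⟨hcubic, fun x hx => ?_⟩
  have hpos : 0 < (9 / 8 : ℝ) * ‖x‖ ^ 2 := by positivity
  rw [hcubic, norm_smul, Real.norm_of_nonneg hpos.le, smul_smul]
  congr 1
  field_simp
end

section
/- Let d ≥ 6 be even and for α ∈ (0,1) define g_d(α) = (α^{d−1} − (1/2)(1−α)^{d−1} + 1/2) / (1 + (1/2)α^{d−1} + (1/2)(1−α)^{d−1}). Then: (i) 0 < g_d(α) < 1 for all α ∈ (0,1); (ii) g_d(1/2) = 1/2; and (iii) for every α ∈ (0,1) with α ≠ 1/2, |g_d(α) − 1/2| < |α − 1/2|. -/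
/-- For `x + y = 1` the left-hand sides `F n` satisfy `F (n + 2) = F (n + 1) - x * y * F n`. -/
theorem pow_mul_add_two_mul_sub_lt {x y : ℝ} (hy : 0 < y) (hyx : y < x) (hxy : x + y = 1)
    {n : ℕ} (hn : 4 ≤ n) :
    x ^ n * (x + 2 * y) - y ^ n * (y + 2 * x) < x - y := by
  have hx : 0 < x := hy.trans hyx
  induction n, hn using Nat.le_induction with
  | base =>
    have hp : 0 < (x - y) * (x * y * (1 + x * y)) :=
      mul_pos (sub_pos.2 hyx) (by positivity)
    obtain rfl : x = 1 - y := by linarith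
    linear_combination hp
  | succ n hn ih =>
    obtain ⟨m, rfl⟩ : ∃ m, n = m + 2 := ⟨n - 2, by omega⟩
    have hpow : y ^ m ≤ x ^ m := pow_le_pow_left₀ hy.le hyx.le m
    have hle : y ^ m * (y * (y + 2 * x)) ≤ x ^ m * (x * (x + 2 * y)) :=
      mul_le_mul hpow (by nlinarith) (by positivity) (by positivity)
    have hstep := mul_nonneg (mul_pos hx hy).le (sub_nonneg.2 hle)
    obtain rfl : x = 1 - y := by linarith
    linear_combination ih + hstep

/-- The quotient is the displacement from `1 / 2` of the ratio map. -/
theorem three_quarters_mul_pow_sub_div_lt {x y : ℝ} (hy : 0 < y) (hyx : y < x)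
    (hxy : x + y = 1) {n : ℕ} (hn : 4 ≤ n) :
    |3 / 4 * (x ^ n - y ^ n) / (1 + 1 / 2 * x ^ n + 1 / 2 * y ^ n)| < x - 1 / 2 := by
  have hx : 0 < x := hy.trans hyx
  have hpow : y ^ n ≤ x ^ n := pow_le_pow_left₀ hy.le hyx.le n
  rw [abs_of_nonneg (div_nonneg (by linarith) (by positivity)), div_lt_iff₀ (by positivity)]
  have h := pow_mul_add_two_mul_sub_lt hy hyx hxy hn
  obtain rfl : x = 1 - y := by linarith
  linear_combination h / 2

/-- For even `d ≥ 6` and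
`g_d(α) = (α^{d−1} − (1/2)(1−α)^{d−1} + 1/2) / (1 + (1/2)α^{d−1} + (1/2)(1−α)^{d−1})`:
(i) `0 < g_d(α) < 1` on `(0,1)`; (ii) `g_d(1/2) = 1/2`;
(iii) `|g_d(α) − 1/2| < |α − 1/2|` for `α ∈ (0,1)`, `α ≠ 1/2`. -/
theorem simplex_ratio_map_contracts (d : ℕ) (hd : 6 ≤ d) (heven : Even d)
    (g : ℝ → ℝ)
    (hg : ∀ α : ℝ, g α =
      (α ^ (d - 1) - (1 / 2) * (1 - α) ^ (d - 1) + 1 / 2) /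
        (1 + (1 / 2) * α ^ (d - 1) + (1 / 2) * (1 - α) ^ (d - 1))) :
    (∀ α : ℝ, α ∈ Set.Ioo (0 : ℝ) 1 → 0 < g α ∧ g α < 1) ∧
    g (1 / 2) = 1 / 2 ∧
    (∀ α : ℝ, α ∈ Set.Ioo (0 : ℝ) 1 → α ≠ 1 / 2 →
      |g α - 1 / 2| < |α - 1 / 2|) := by
  have hdisp : ∀ α : ℝ, α ∈ Set.Ioo (0 : ℝ) 1 → g α - 1 / 2 =
      3 / 4 * (α ^ (d - 1) - (1 - α) ^ (d - 1)) /
        (1 + 1 / 2 * α ^ (d - 1) + 1 / 2 * (1 - α) ^ (d - 1)) := by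
    rintro α ⟨h0, h1⟩
    have ha : 0 < α ^ (d - 1) := pow_pos h0 _
    have hb : 0 < (1 - α) ^ (d - 1) := pow_pos (sub_pos.2 h1) _
    rw [hg, eq_div_iff (by positivity), sub_mul, div_mul_cancel₀ _ (by positivity)]
    ring
  refine ⟨?_, ?_, ?_⟩
  · rintro α ⟨h0, h1⟩
    have ha : 0 < α ^ (d - 1) := pow_pos h0 _
    have hb : 0 < (1 - α) ^ (d - 1) := pow_pos (sub_pos.2 h1) _
    have ha' : α ^ (d - 1) ≤ 1 := pow_le_one₀ h0.le h1.le
    have hb' : (1 - α) ^ (d - 1) ≤ 1 := pow_le_one₀ (by linarith) (by linarith)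
    rw [hg]
    exact ⟨div_pos (by linarith) (by positivity),
      (div_lt_one (by positivity)).2 (by linarith)⟩
  · have h := hdisp (1 / 2) (by norm_num)
    norm_num at h
    linarith
  · intro α hα hne
    rw [hdisp α hα]
    obtain ⟨h0, h1⟩ := hα
    rcases lt_or_gt_of_ne hne with h | h
    · have key := three_quarters_mul_pow_sub_div_lt (x := 1 - α) (y := α) h0 (by linarith)
        (by ring) (n := d - 1) (by omega)
      rw [abs_of_neg (sub_neg.2 h), ← abs_neg]
      convert key using 1
      · congr 1
        ring
      · ring
    · rw [abs_of_pos (sub_pos.2 h)]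
      exact three_quarters_mul_pow_sub_div_lt (by linarith) (by linarith) (by ring) (by omega)
end

section
/- Let φ = (1+√5)/2, c = 1/√(1+φ²), and define the icosahedral frame v_1 = c·(0,1,φ), v_2 = c·(0,−1,φ), v_3 = c·(1,φ,0), v_4 = c·(−1,φ,0), v_5 = c·(φ,0,1), v_6 = c·(−φ,0,1) in ℝ³. Then for every d ≥ 2, Σ_{i=1}^6 ⟨v_i, v_1⟩^{d−1} v_i = (1 + (1/√5)^{d−2})·v_1; i.e. v_1 is an eigenvector of the tensor T = Σ_{i=1}^6 v_i^{⊗d} with eigenvalue 1 + (1/√5)^{d−2}, regardless of the parity of d. -/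
open scoped RealInnerProductSpace

/-- The constant `c` normalizes `(0, 1, φ)` and makes the inner product `c² φ` of distinct frame
vectors equal to `1/√5`. -/
lemma icosahedral_normalization (φ c : ℝ) (hφ : φ = (1 + Real.sqrt 5) / 2)
    (hc : c = 1 / Real.sqrt (1 + φ ^ 2)) :
    c ^ 2 * (1 + φ ^ 2) = 1 ∧ c ^ 2 * φ = 1 / Real.sqrt 5 := by
  have hs : Real.sqrt 5 ^ 2 = 5 := Real.sq_sqrt (by norm_num)
  have hs0 : 0 < Real.sqrt 5 := Real.sqrt_pos.2 (by norm_num)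
  have hpos : 0 < 1 + φ ^ 2 := by positivity
  have hunit : c ^ 2 * (1 + φ ^ 2) = 1 := by
    rw [hc, div_pow, Real.sq_sqrt hpos.le, one_pow, one_div_mul_cancel hpos.ne']
  refine ⟨hunit, ?_⟩
  have hφs : 1 + φ ^ 2 = φ * Real.sqrt 5 := by
    rw [hφ]
    linear_combination (-1 / 4 : ℝ) * hs
  rw [eq_div_iff hs0.ne', mul_assoc, ← hφs, hunit]

/-- For the icosahedral frame in `ℝ³` (unit vectors along the diagonals
of a regular icosahedron), `v₁` is an eigenvector of the tensor `T = ∑ i, (v i)^{⊗d}`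
with eigenvalue `1 + (1/√5)^{d−2}` for every `d ≥ 2`, regardless of the parity of `d`. -/
theorem icosahedral_first_vector_is_eigenvector
    (φ c : ℝ) (hφ : φ = (1 + Real.sqrt 5) / 2) (hc : c = 1 / Real.sqrt (1 + φ ^ 2))
    (v : Fin 6 → EuclideanSpace ℝ (Fin 3))
    (hv : v = fun i => c •
      (WithLp.equiv 2 (Fin 3 → ℝ)).symm
        (![![0, 1, φ], ![0, -1, φ], ![1, φ, 0], ![-1, φ, 0], ![φ, 0, 1], ![-φ, 0, 1]] i)) :
    ∀ d : ℕ, 2 ≤ d →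
      (∑ i, ((⟪v i, v 0⟫ : ℝ) ^ (d - 1)) • v i) =
        (1 + (1 / Real.sqrt 5) ^ (d - 2)) • v 0 := by
  intro d hd
  obtain ⟨k, rfl⟩ := Nat.exists_eq_add_of_le' hd
  obtain ⟨hunit, hinner⟩ := icosahedral_normalization φ c hφ hc
  have hs : Real.sqrt 5 ^ 2 = 5 := Real.sq_sqrt (by norm_num)
  have hs0 : Real.sqrt 5 ≠ 0 := (Real.sqrt_pos.2 (by norm_num)).ne'
  have hgold : φ ^ 2 = φ + 1 := by
    rw [hφ]
    linear_combination (1 / 4 : ℝ) * hs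
  have hsφ : Real.sqrt 5 = 2 * φ - 1 := by
    rw [hφ]
    ring
  have h0 : ⟪v 0, v 0⟫ = 1 := by
    rw [PiLp.inner_apply, Fin.sum_univ_three]
    simp [hv, mul_pow]
    linear_combination hunit
  have hi : ∀ i : Fin 6, i ≠ 0 → ⟪v i, v 0⟫ = 1 / Real.sqrt 5 := by
    intro i hi
    rw [← hinner]
    fin_cases i <;> simp [hv, PiLp.inner_apply, Fin.sum_univ_three] at hi ⊢
    · linear_combination c ^ 2 * hgold
    all_goals ring
  have hsum : v 1 + v 2 + v 3 + v 4 + v 5 = Real.sqrt 5 • v 0 := by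
    rw [hsφ]
    ext j
    fin_cases j <;> simp [hv]
    · ring
    · linear_combination (-2 * c) * hgold
  have hpow : (1 / Real.sqrt 5) ^ (k + 1) * Real.sqrt 5 = (1 / Real.sqrt 5) ^ k := by
    rw [pow_succ, mul_assoc, one_div_mul_cancel hs0, mul_one]
  rw [show k + 2 - 1 = k + 1 by omega, Nat.add_sub_cancel, Fin.sum_univ_six, h0,
    hi 1 (by decide), hi 2 (by decide), hi 3 (by decide), hi 4 (by decide), hi 5 (by decide),
    one_pow, add_smul, ← hpow, mul_smul, ← hsum]
  module
end

section
/- Let φ = (1+√5)/2, c = 1/√(1+φ²), and define the icosahedral frame v_1 = c·(0,1,φ), v_2 = c·(0,−1,φ), v_3 = c·(1,φ,0), v_4 = c·(−1,φ,0), v_5 = c·(φ,0,1), v_6 = c·(−φ,0,1) in ℝ³. Then for every d ≥ 5 (of either parity), v_1 is a robust eigenvector of F_d, where F_d(x) = Σ_{i=1}^6 ⟨v_i, x⟩^{d−1} v_i; in particular the bound 2(d−1)(1/√5)^{d−2} < 1 + (1/√5)^{d−2} holds for all d ≥ 5. -/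
open Filter
open scoped RealInnerProductSpace

section PowerMethod

variable {E : Type*} [NormedAddCommGroup E]

/-- A fixed point at which the derivative has norm `< 1` is attracting. -/
theorem HasFDerivAt.exists_tendsto_iterate_of_norm_lt_one [NormedSpace ℝ E]
    {f : E → E} {D : E →L[ℝ] E} {p : E} (hf : HasFDerivAt f D p) (hp : f p = p) (hD : ‖D‖ < 1) :
    ∃ ε > (0 : ℝ), ∀ x : ℕ → E, ‖x 0 - p‖ < ε → (∀ k, x (k + 1) = f (x k)) →
      Tendsto x atTop (nhds p) := by
  obtain ⟨q, hDq, hq⟩ := exists_between hD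
  have hq0 : 0 ≤ q := (norm_nonneg D).trans hDq.le
  have hev : ∀ᶠ y in nhds p, ‖f y - p‖ ≤ q * ‖y - p‖ := by
    filter_upwards [hf.isLittleO.def (sub_pos.2 hDq)] with y hy
    rw [hp] at hy
    calc ‖f y - p‖ = ‖(f y - p - D (y - p)) + D (y - p)‖ := by rw [sub_add_cancel]
      _ ≤ (q - ‖D‖) * ‖y - p‖ + ‖D‖ * ‖y - p‖ :=
        (norm_add_le _ _).trans (add_le_add hy (D.le_opNorm _))
      _ = q * ‖y - p‖ := by ring
  obtain ⟨ε, hε, hball⟩ := Metric.eventually_nhds_iff.1 hev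
  refine ⟨ε, hε, fun x hx0 hx => ?_⟩
  have hgeom : ∀ k, ‖x k - p‖ ≤ q ^ k * ‖x 0 - p‖ := by
    intro k
    induction k with
    | zero => simp
    | succ k ih =>
      have hlt : ‖x k - p‖ < ε :=
        (ih.trans (mul_le_of_le_one_left (norm_nonneg _) (pow_le_one₀ hq0 hq.le))).trans_lt hx0
      rw [hx k, pow_succ', mul_assoc]
      exact (hball (by rwa [dist_eq_norm])).trans (mul_le_mul_of_nonneg_left ih hq0)
  rw [tendsto_iff_norm_sub_tendsto_zero]
  refine squeeze_zero (fun _ => norm_nonneg _) hgeom ?_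
  simpa using (tendsto_pow_atTop_nhds_zero_of_lt_one hq0 hq).mul_const ‖x 0 - p‖

variable [InnerProductSpace ℝ E]

/-- The derivative of `y ↦ y / ‖y‖` at `l • p`, with `p` a unit vector, is `l⁻¹` times the
orthogonal projection onto the complement of `p`. -/
theorem hasFDerivAt_inv_norm_smul_self {p : E} (hp : ‖p‖ = 1) {l : ℝ} (hl : 0 < l) :
    HasFDerivAt (fun y : E => ‖y‖⁻¹ • y)
      (l⁻¹ • (ContinuousLinearMap.id ℝ E - (innerSL ℝ p).smulRight p)) (l • p) := by
  have hn : ‖l • p‖ = l := by rw [norm_smul, hp, mul_one, Real.norm_of_nonneg hl.le]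
  have hne : ‖l • p‖ ^ 2 ≠ 0 := by rw [hn]; positivity
  have hsq : HasFDerivAt (fun y : E => ‖y‖ ^ 2) (2 • innerSL ℝ (l • p)) (l • p) :=
    (hasStrictFDerivAt_norm_sq (l • p)).hasFDerivAt
  have hnorm := hsq.sqrt hne
  simp only [Real.sqrt_sq (norm_nonneg _), hn, Real.sqrt_sq hl.le] at hnorm
  have hinv := (hasDerivAt_inv (x := ‖l • p‖) (by rw [hn]; exact hl.ne')).comp_hasFDerivAt
    (l • p) hnorm
  refine (hinv.smul (hasFDerivAt_id (𝕜 := ℝ) (l • p))).congr_fderiv ?_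
  ext h
  simp [hn, smul_smul]
  match_scalars <;> field_simp

variable {ι : Type*} [Fintype ι]

/-- The weighted frame operator of an equiangular tight frame. -/
theorem sum_inner_pow_mul_inner_smul [DecidableEq ι] {v : ι → E} {j : ι} {α A : ℝ}
    (hj : ‖v j‖ = 1) (hα : ∀ i, i ≠ j → ⟪v i, v j⟫ = α)
    (hA : ∀ h, ∑ i, ⟪v i, h⟫ • v i = A • h) (m : ℕ) (h : E) :
    ∑ i, (⟪v i, v j⟫ ^ m * ⟪v i, h⟫) • v i =
      (α ^ m * A) • h + ((1 - α ^ m) * ⟪v j, h⟫) • v j := by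
  have hterm : ∀ i, (⟪v i, v j⟫ ^ m * ⟪v i, h⟫) • v i =
      α ^ m • (⟪v i, h⟫ • v i) + if i = j then ((1 - α ^ m) * ⟪v j, h⟫) • v j else 0 := by
    intro i
    by_cases hij : i = j
    · subst hij
      rw [real_inner_self_eq_norm_sq, hj, if_pos rfl, smul_smul, ← add_smul]
      congr 1
      ring
    · rw [hα i hij, if_neg hij, add_zero, smul_smul]
  simp_rw [hterm, Finset.sum_add_distrib, ← Finset.smul_sum, hA, smul_smul]
  simp

/-- A vector making the same angle with all other members of a tight frame is a robust
eigenvector of the tensor power method, provided that the derivative there is a contraction. -/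
theorem exists_tendsto_power_method {v : ι → E} {j : ι} {α A : ℝ}
    (hj : ‖v j‖ = 1) (hα : ∀ i, i ≠ j → ⟪v i, v j⟫ = α) (hα0 : 0 ≤ α) (hA0 : 0 ≤ A)
    (hA : ∀ h, ∑ i, ⟪v i, h⟫ • v i = A • h) (m : ℕ)
    (hm : A * (m + 1) * α ^ m < 1 + (A - 1) * α ^ m) :
    ∃ ε > (0 : ℝ), ∀ x : ℕ → E, ‖x 0 - v j‖ < ε →
      (∀ k, x (k + 1) = ‖∑ i, (⟪v i, x k⟫ ^ (m + 1)) • v i‖⁻¹ •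
        (∑ i, (⟪v i, x k⟫ ^ (m + 1)) • v i)) →
      Tendsto x atTop (nhds (v j)) := by
  classical
  set l : ℝ := 1 + (A - 1) * α ^ m with hl_def
  have hl : 0 < l := lt_of_le_of_lt (by positivity) hm
  let F : E → E := fun x => ∑ i, (⟪v i, x⟫ ^ (m + 1)) • v i
  have hFj : F (v j) = l • v j := by
    have h := sum_inner_pow_mul_inner_smul hj hα hA m (v j)
    simp only [← pow_succ, real_inner_self_eq_norm_sq, hj, ← add_smul] at h
    rw [show F (v j) = _ from h, hl_def]
    congr 1
    ring
  have hF : HasFDerivAt F (∑ i, (((m + 1 : ℕ) * ⟪v i, v j⟫ ^ m) • innerSL ℝ (v i)).smulRight (v i))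
      (v j) := by
    refine HasFDerivAt.fun_sum fun i _ => ?_
    have h := ((innerSL ℝ (v i)).hasFDerivAt (x := v j)).pow (m + 1)
    simpa [nsmul_eq_mul] using h.smul_const (v i)
  have hN := hasFDerivAt_inv_norm_smul_self hj hl
  rw [← hFj] at hN
  refine (hN.comp (v j) hF).exists_tendsto_iterate_of_norm_lt_one ?_ ?_
  · simp [Function.comp, hFj, norm_smul, hj, abs_of_pos hl, smul_smul, hl.ne']
  · refine lt_of_le_of_lt (b := A * (m + 1) * α ^ m / l) ?_ ((div_lt_one hl).2 hm)
    refine ContinuousLinearMap.opNorm_le_bound _ (by positivity) fun h => ?_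
    have hS : (∑ i, (((m + 1 : ℕ) * ⟪v i, v j⟫ ^ m) • innerSL ℝ (v i)).smulRight (v i)) h =
        ((m : ℝ) + 1) • ((α ^ m * A) • h + ((1 - α ^ m) * ⟪v j, h⟫) • v j) := by
      rw [← sum_inner_pow_mul_inner_smul hj hα hA m h, Finset.smul_sum]
      simp [smul_smul, mul_assoc]
    have hproj : ‖h - ⟪v j, h⟫ • v j‖ ≤ ‖h‖ := by
      refine (sq_le_sq₀ (norm_nonneg _) (norm_nonneg h)).1 ?_
      rw [norm_sub_sq_real, inner_smul_right, norm_smul, hj, real_inner_comm, Real.norm_eq_abs,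
        mul_one, sq_abs]
      nlinarith [sq_nonneg ⟪v j, h⟫]
    have hcomp : (l⁻¹ • (ContinuousLinearMap.id ℝ E - (innerSL ℝ (v j)).smulRight (v j)))
        (((m : ℝ) + 1) • ((α ^ m * A) • h + ((1 - α ^ m) * ⟪v j, h⟫) • v j)) =
        (A * (m + 1) * α ^ m / l) • (h - ⟪v j, h⟫ • v j) := by
      simp [inner_add_right, inner_smul_right, hj]
      module
    rw [ContinuousLinearMap.comp_apply, hS, hcomp, norm_smul, Real.norm_of_nonneg (by positivity)]
    exact mul_le_mul_of_nonneg_left hproj (by positivity)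

end PowerMethod

theorem two_mul_add_one_lt_two_pow {m : ℕ} (hm : 3 ≤ m) : 2 * m + 1 < 2 ^ m := by
  induction m, hm using Nat.le_induction with
  | base => norm_num
  | succ m hm ih => rw [pow_succ]; omega

theorem two_mul_succ_mul_inv_sqrt_five_pow_lt {m : ℕ} (hm : 3 ≤ m) :
    2 * ((m : ℝ) + 1) * (1 / Real.sqrt 5) ^ m < 1 + (1 / Real.sqrt 5) ^ m := by
  have h2 : (2 : ℝ) ≤ Real.sqrt 5 := Real.le_sqrt_of_sq_le (by norm_num)
  have hpow : (2 * (m : ℝ) + 1) < Real.sqrt 5 ^ m :=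
    lt_of_lt_of_le (by exact_mod_cast two_mul_add_one_lt_two_pow hm)
      (pow_le_pow_left₀ (by norm_num) h2 m)
  have hpos : (0 : ℝ) < Real.sqrt 5 ^ m := by positivity
  have h1 : (2 * (m : ℝ) + 1) * (1 / Real.sqrt 5) ^ m < 1 := by
    rw [div_pow, one_pow, mul_one_div, div_lt_one hpos]
    exact hpow
  linarith

/-- For the icosahedral frame in `ℝ³`, for every `d ≥ 5` (of either
parity) the bound `2(d−1)(1/√5)^{d−2} < 1 + (1/√5)^{d−2}` holds and `v₁` is a robust
eigenvector of `F_d(x) = ∑ i, ⟨v_i, x⟩^{d−1} v_i`. -/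
theorem icosahedral_first_vector_robust
    (φ c : ℝ) (hφ : φ = (1 + Real.sqrt 5) / 2) (hc : c = 1 / Real.sqrt (1 + φ ^ 2))
    (v : Fin 6 → EuclideanSpace ℝ (Fin 3))
    (hv : v = fun i => c •
      (WithLp.equiv 2 (Fin 3 → ℝ)).symm
        (![![0, 1, φ], ![0, -1, φ], ![1, φ, 0], ![-1, φ, 0], ![φ, 0, 1], ![-φ, 0, 1]] i)) :
    ∀ d : ℕ, 5 ≤ d →
      2 * ((d : ℝ) - 1) * (1 / Real.sqrt 5) ^ (d - 2) < 1 + (1 / Real.sqrt 5) ^ (d - 2) ∧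
      ∃ ε > (0 : ℝ), ∀ x : ℕ → EuclideanSpace ℝ (Fin 3),
        ‖x 0 - v 0‖ < ε →
        (∀ k : ℕ, x (k + 1) =
          ‖∑ i, ((⟪v i, x k⟫ : ℝ) ^ (d - 1)) • v i‖⁻¹ •
            (∑ i, ((⟪v i, x k⟫ : ℝ) ^ (d - 1)) • v i)) →
        Tendsto x atTop (nhds (v 0)) := by
  intro d hd
  obtain ⟨m, rfl⟩ : ∃ m, d = m + 2 := ⟨d - 2, by omega⟩
  have hbound := two_mul_succ_mul_inv_sqrt_five_pow_lt (m := m) (by omega)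
  have hm2 : m + 2 - 2 = m := by omega
  have hm1 : m + 2 - 1 = m + 1 := by omega
  rw [hm2, hm1]
  refine ⟨by push_cast; convert hbound using 3; ring, ?_⟩
  have h5 : Real.sqrt 5 ^ 2 = 5 := Real.sq_sqrt (by norm_num)
  have h5pos : 0 < Real.sqrt 5 := by positivity
  have hφ2 : φ ^ 2 = φ + 1 := by rw [hφ]; linarith
  have hcc : c ^ 2 * (φ + 2) = 1 := by
    have hpos : 0 < 1 + φ ^ 2 := by positivity
    rw [hc, div_pow, Real.sq_sqrt hpos.le, one_pow, show φ + 2 = 1 + φ ^ 2 by linarith]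
    field_simp
  have hα : c ^ 2 * φ = 1 / Real.sqrt 5 := by
    have hφ5 : φ * Real.sqrt 5 = φ + 2 := by rw [hφ]; linarith
    rw [eq_div_iff h5pos.ne', mul_assoc, hφ5, hcc]
  have hinner : ∀ i (y : EuclideanSpace ℝ (Fin 3)), ⟪v i, y⟫ = c * (
      ![![0, 1, φ], ![0, -1, φ], ![1, φ, 0], ![-1, φ, 0], ![φ, 0, 1], ![-φ, 0, 1]] i 0 * y 0 +
      ![![0, 1, φ], ![0, -1, φ], ![1, φ, 0], ![-1, φ, 0], ![φ, 0, 1], ![-φ, 0, 1]] i 1 * y 1 +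
      ![![0, 1, φ], ![0, -1, φ], ![1, φ, 0], ![-1, φ, 0], ![φ, 0, 1], ![-φ, 0, 1]] i 2 * y 2) := by
    intro i y
    rw [hv, inner_smul_left]
    simp [PiLp.inner_apply, Fin.sum_univ_three]
    exact Or.inl (by ring)
  have hv0 : v 0 0 = 0 ∧ v 0 1 = c ∧ v 0 2 = c * φ := by simp [hv]
  obtain ⟨hx, hy, hz⟩ := hv0
  refine exists_tendsto_power_method (α := 1 / Real.sqrt 5) (A := 2) ?_ ?_ (by positivity)
    (by norm_num) ?_ m (by linarith)
  · have h : ⟪v 0, v 0⟫ = 1 := by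
      rw [hinner, hx, hy, hz]
      simp
      linear_combination hcc + c ^ 2 * hφ2
    rw [real_inner_self_eq_norm_sq] at h
    exact (pow_eq_one_iff_of_nonneg (norm_nonneg _) two_ne_zero).1 h
  · intro i hi
    rw [hinner, hx, hy, hz, ← hα]
    fin_cases i
    · exact absurd rfl hi
    all_goals simp
    all_goals first | ring1 | linear_combination c ^ 2 * hφ2
  · intro h
    simp only [hinner]
    rw [hv]
    ext k
    fin_cases k
    all_goals simp [Fin.sum_univ_six]
    · linear_combination (2 * h 0) * hcc + (2 * h 0 * c ^ 2) * hφ2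
    · linear_combination (2 * h 1) * hcc + (2 * h 1 * c ^ 2) * hφ2
    · linear_combination (2 * h 2) * hcc + (2 * h 2 * c ^ 2) * hφ2
end

section
/- Let v_1, …, v_n be an orthonormal basis of ℝ^n, let λ_1, …, λ_n be nonzero reals, and let d ≥ 3. Then for every j ∈ {1,…,n}, F_d(v_j) = λ_j·v_j, and v_j is a robust (up to sign) eigenvector of F_d; i.e. the generating vectors of an orthogonally decomposable tensor T = Σ_{i=1}^n λ_i v_i^{⊗d} are robust eigenvectors for every order d ≥ 3. -/
open Filter
open scoped RealInnerProductSpace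

/-- The contraction `T·x^e` of the odeco tensor with orthonormal factors `b` and weights `lam`
has `i`-th coordinate `lam i * ⟪b i, x⟫ ^ e`. -/
lemma inner_odeco_contraction {n : ℕ} (e : ℕ)
    (b : OrthonormalBasis (Fin n) ℝ (EuclideanSpace ℝ (Fin n)))
    (lam : Fin n → ℝ) (x : EuclideanSpace ℝ (Fin n)) (i : Fin n) :
    ⟪b i, ∑ l, (lam l * ⟪b l, x⟫ ^ e) • b l⟫ = lam i * ⟪b i, x⟫ ^ e :=
  b.orthonormal.inner_right_fintype (fun l => lam l * ⟪b l, x⟫ ^ e) i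

/-- If `|a| ≤ |c| q` with `q` small relative to the ratio bound `M` of the weights, then the
power step `a ↦ s μ a ^ e`, `c ↦ s ν c ^ e` at least halves the bound `q`. -/
lemma abs_power_step_le {e : ℕ} (he : 2 ≤ e) {a c s μ ν M q : ℝ} (hs : 0 ≤ s)
    (hM : 1 ≤ M) (hμ : |μ| ≤ M * |ν|) (hq : 0 ≤ q) (hMq : M * q ≤ 1 / 2)
    (ha : |a| ≤ |c| * q) :
    |s * (μ * a ^ e)| ≤ |s * (ν * c ^ e)| * (q / 2) := by
  have hq1 : q ≤ 1 := by nlinarith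
  have hqe : q ^ e ≤ q ^ 2 := pow_le_pow_of_le_one hq hq1 he
  have hMqe : M * q ^ e ≤ q / 2 := by nlinarith
  rw [abs_mul, abs_mul, abs_mul, abs_mul, abs_pow, abs_pow, abs_of_nonneg hs]
  calc s * (|μ| * |a| ^ e) ≤ s * ((M * |ν|) * (|c| * q) ^ e) := by gcongr
    _ = s * (|ν| * |c| ^ e) * (M * q ^ e) := by rw [mul_pow]; ring
    _ ≤ s * (|ν| * |c| ^ e) * (q / 2) := by gcongr

/-- A unit vector whose coordinates other than the `j`-th are at most `q` in absolute value is
within `2 n q` of `b j` up to sign. -/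
lemma min_norm_sub_add_le {n : ℕ}
    (b : OrthonormalBasis (Fin n) ℝ (EuclideanSpace ℝ (Fin n))) (j : Fin n)
    {y : EuclideanSpace ℝ (Fin n)} (hy : ‖y‖ = 1) {q : ℝ} (hq : 0 ≤ q)
    (h : ∀ i, i ≠ j → |⟪b i, y⟫| ≤ q) :
    min ‖y - b j‖ ‖y + b j‖ ≤ 2 * n * q := by
  have hn : (1 : ℝ) ≤ n := by exact_mod_cast j.pos
  have hsum : ∑ i, ⟪b i, y⟫ ^ 2 = 1 := by
    have := b.sum_sq_norm_inner_right y
    simpa [hy] using this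
  rw [← Finset.add_sum_erase _ _ (Finset.mem_univ j)] at hsum
  have hrest : ∑ i ∈ Finset.univ.erase j, ⟪b i, y⟫ ^ 2 ≤ n * q ^ 2 := by
    calc ∑ i ∈ Finset.univ.erase j, ⟪b i, y⟫ ^ 2
        ≤ ∑ i ∈ Finset.univ.erase j, q ^ 2 := by
          refine Finset.sum_le_sum fun i hi => ?_
          exact sq_le_sq.2 ((h i (Finset.ne_of_mem_erase hi)).trans (le_abs_self q))
      _ ≤ ∑ _i : Fin n, q ^ 2 :=
          Finset.sum_le_sum_of_subset_of_nonneg (Finset.erase_subset _ _)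
            fun _ _ _ => sq_nonneg q
      _ = n * q ^ 2 := by simp
  have hnonneg : 0 ≤ ∑ i ∈ Finset.univ.erase j, ⟪b i, y⟫ ^ 2 :=
    Finset.sum_nonneg fun _ _ => sq_nonneg _
  have hsub := norm_sub_sq_real y (b j)
  have hadd := norm_add_sq_real y (b j)
  rw [real_inner_comm, hy, b.norm_eq_one] at hsub hadd
  have hnq : 2 * (n * q ^ 2) ≤ (2 * n * q) ^ 2 := by
    nlinarith [mul_nonneg (mul_nonneg (by linarith : (0 : ℝ) ≤ n) (sub_nonneg.2 hn)) (sq_nonneg q),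
      mul_nonneg (by linarith : (0 : ℝ) ≤ n) (sq_nonneg q)]
  have hnq0 : 0 ≤ 2 * n * q := by positivity
  rcases le_total 0 ⟪b j, y⟫ with hc | hc
  · refine (min_le_left _ _).trans (abs_le_of_sq_le_sq' ?_ hnq0).2
    nlinarith
  · refine (min_le_right _ _).trans (abs_le_of_sq_le_sq' ?_ hnq0).2
    nlinarith

theorem odeco_generators_are_robust_eigenvectors {n : ℕ} (d : ℕ) (hd : 3 ≤ d)
    (b : OrthonormalBasis (Fin n) ℝ (EuclideanSpace ℝ (Fin n)))
    (lam : Fin n → ℝ) (hlam : ∀ i, lam i ≠ 0) :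
    ∀ j : Fin n,
      (∑ i, (lam i * ⟪b i, b j⟫ ^ (d - 1)) • b i) = lam j • b j ∧
      ∃ ε > (0 : ℝ), ∀ x : ℕ → EuclideanSpace ℝ (Fin n),
        ‖x 0 - b j‖ < ε →
        (∀ k : ℕ, x (k + 1) =
          ‖∑ i, (lam i * ⟪b i, x k⟫ ^ (d - 1)) • b i‖⁻¹ •
            (∑ i, (lam i * ⟪b i, x k⟫ ^ (d - 1)) • b i)) →
        Tendsto (fun k => min ‖x k - b j‖ ‖x k + b j‖) atTop (nhds 0) := by
  intro j
  have he : 2 ≤ d - 1 := by omega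
  refine ⟨?_, ?_⟩
  · rw [Finset.sum_eq_single j]
    · simp
    · intro i _ hij
      rw [b.orthonormal.inner_eq_zero hij, zero_pow (by omega), mul_zero, zero_smul]
    · simp
  generalize d - 1 = e at he
  obtain ⟨M, hM1, hM⟩ : ∃ M : ℝ, 1 ≤ M ∧ ∀ i, |lam i| ≤ M * |lam j| := by
    refine ⟨1 + ∑ i, |lam i| / |lam j|, ?_, fun i => ?_⟩
    · have : 0 ≤ ∑ i, |lam i| / |lam j| := Finset.sum_nonneg fun _ _ => by positivity
      linarith
    · rw [← div_le_iff₀ (abs_pos.2 (hlam j))]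
      have := Finset.single_le_sum (f := fun i => |lam i| / |lam j|)
        (fun _ _ => by positivity) (Finset.mem_univ i)
      linarith
  have hM0 : 0 < M := by linarith
  refine ⟨1 / (4 * M), by positivity, fun x hx0 hx => ?_⟩
  set F : ℕ → EuclideanSpace ℝ (Fin n) := fun k => ∑ i, (lam i * ⟪b i, x k⟫ ^ e) • b i with hF
  have hstep : ∀ k i, ⟪b i, x (k + 1)⟫ = ‖F k‖⁻¹ * (lam i * ⟪b i, x k⟫ ^ e) := by
    intro k i
    rw [hx k, real_inner_smul_right, inner_odeco_contraction]
  have hFne : ∀ k, ⟪b j, x k⟫ ≠ 0 → F k ≠ 0 := by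
    intro k hk h0
    have := inner_odeco_contraction e b lam (x k) j
    rw [show ∑ l, (lam l * ⟪b l, x k⟫ ^ e) • b l = 0 from h0, inner_zero_right] at this
    exact mul_ne_zero (hlam j) (pow_ne_zero _ hk) this.symm
  have hinv : ∀ k, ⟪b j, x k⟫ ≠ 0 ∧
      ∀ i, i ≠ j → |⟪b i, x k⟫| ≤ |⟪b j, x k⟫| * (1 / (2 * M) * (1 / 2) ^ k) := by
    intro k
    induction k with
    | zero =>
      have hcoord : ∀ i, |⟪b i, x 0 - b j⟫| < 1 / (4 * M) := fun i =>
        ((abs_real_inner_le_norm _ _).trans (by rw [b.norm_eq_one, one_mul])).trans_lt hx0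
      have hM4 : 1 / (4 * M) ≤ 1 / 4 := by
        apply one_div_le_one_div_of_le <;> linarith
      have hj := hcoord j
      rw [inner_sub_right, real_inner_self_eq_norm_sq, b.norm_eq_one, abs_lt] at hj
      have hc : 1 / 2 ≤ ⟪b j, x 0⟫ := by linarith
      refine ⟨by linarith, fun i hi => ?_⟩
      have hi' := hcoord i
      rw [inner_sub_right, b.orthonormal.inner_eq_zero hi, sub_zero] at hi'
      rw [abs_of_nonneg (by linarith : 0 ≤ ⟪b j, x 0⟫), pow_zero, mul_one]
      calc |⟪b i, x 0⟫| ≤ 1 / (4 * M) := hi'.le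
        _ = 1 / 2 * (1 / (2 * M)) := by field_simp; norm_num
        _ ≤ ⟪b j, x 0⟫ * (1 / (2 * M)) := by gcongr
    | succ k ih =>
      obtain ⟨hc, hk⟩ := ih
      refine ⟨?_, fun i hi => ?_⟩
      · rw [hstep]
        exact mul_ne_zero (inv_ne_zero (norm_ne_zero_iff.2 (hFne k hc)))
          (mul_ne_zero (hlam j) (pow_ne_zero _ hc))
      · have hp : ((1 : ℝ) / 2) ^ k ≤ 1 := pow_le_one₀ (by norm_num) (by norm_num)
        have hMq : M * (1 / (2 * M) * (1 / 2) ^ k) ≤ 1 / 2 := by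
          rw [show M * (1 / (2 * M) * (1 / 2) ^ k) = 1 / 2 * (1 / 2 : ℝ) ^ k by field_simp]
          linarith
        rw [hstep, hstep, pow_succ, ← mul_assoc (1 / (2 * M)), mul_one_div]
        exact abs_power_step_le he (by positivity) hM1 (hM i) (by positivity) hMq (hk i hi)
  have hnorm : ∀ k, ‖x (k + 1)‖ = 1 := by
    intro k
    rw [hx k]
    exact norm_smul_inv_norm (𝕜 := ℝ) (hFne k (hinv k).1)
  rw [← tendsto_add_atTop_iff_nat 1]
  have hlim : Tendsto (fun k : ℕ => 2 * n * (1 / (2 * M) * (1 / 2 : ℝ) ^ (k + 1))) atTop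
      (nhds 0) := by
    have := ((tendsto_pow_atTop_nhds_zero_of_lt_one (r := (1 / 2 : ℝ)) (by norm_num)
      (by norm_num)).comp (tendsto_add_atTop_nat 1)).const_mul (1 / (2 * M))
    simpa using this.const_mul (2 * (n : ℝ))
  refine squeeze_zero (fun k => le_min (norm_nonneg _) (norm_nonneg _)) (fun k => ?_) hlim
  refine min_norm_sub_add_le b j (hnorm k) (by positivity) fun i hi => ?_
  have hc1 : |⟪b j, x (k + 1)⟫| ≤ 1 :=
    (abs_real_inner_le_norm _ _).trans (by rw [b.norm_eq_one, hnorm k, one_mul])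
  exact ((hinv (k + 1)).2 i hi).trans (mul_le_of_le_one_left (by positivity) hc1)
end
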